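/- Assume GRH. Then for every prime p with p ≥ 10^49, the least prime primitive root modulo p satisfies ĝ(p) < √p − 2. -/

import Mathlib

/-- The Generalized Riemann Hypothesis: for every Dirichlet character `χ` (to any modulus),
every zero `s` of the Dirichlet L-function `L(s, χ)` with `0 < Re s < 1` has `Re s = 1/2`. -/
def GRH : Prop :=
  ∀ (N : ℕ) (_ : NeZero N) (χ : DirichletCharacter ℂ N) (s : ℂ),
    DirichletCharacter.LFunction χ s = 0 → 0 < s.re → s.re < 1 → s.re = 1 / 2

/-- The least prime `q` that is a primitive root modulo `p`. -/
noncomputable def leastPrimePrimitiveRoot (p : ℕ) : ℕ :=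
  sInf {q : ℕ | q.Prime ∧ orderOf (q : ZMod p) = p - 1}

section GLAnalytic

open Complex MeasureTheory Set Filter Topology

lemma gl_shift {g : ℂ → ℂ} {a b : ℝ} (hab : a ≤ b) {B : ℝ → ℝ} (hB : Tendsto B atTop (𝓝 0))
    (hg : DifferentiableOn ℂ g {s | a ≤ s.re ∧ s.re ≤ b})
    (hbd : ∀ s : ℂ, a ≤ s.re → s.re ≤ b → 1 ≤ |s.im| → ‖g s‖ ≤ B |s.im|)
    (h1 : Integrable (fun t : ℝ => g (a + t * I)))
    (h2 : Integrable (fun t : ℝ => g (b + t * I))) :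
    ∫ t : ℝ, g (a + t * I) = ∫ t : ℝ, g (b + t * I) := by
  have t1 := intervalIntegral_tendsto_integral h1 tendsto_neg_atTop_atBot tendsto_id
  have t2 := intervalIntegral_tendsto_integral h2 tendsto_neg_atTop_atBot tendsto_id
  have t3 : Tendsto (fun T : ℝ => (∫ t in (-T)..(id T), g (b + t * I)) -
      ∫ t in (-T)..(id T), g (a + t * I)) atTop (𝓝 0) := by
    have hB' : Tendsto (fun T => 2 * (b - a) * B T) atTop (𝓝 0) := by
      simpa using hB.const_mul (2 * (b - a))
    apply squeeze_zero_norm' _ hB'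
    filter_upwards [eventually_ge_atTop 1] with T hT
    have H := integral_boundary_rect_eq_zero_of_differentiableOn g (a - T * I) (b + T * I) (by
      apply hg.mono
      intro s hs
      simp [mem_reProdIm, uIcc_of_le hab] at hs
      exact hs.1)
    simp at H
    have e : ∀ c : ℝ, |c| = T → ‖∫ x : ℝ in a..b, g (x + c * I)‖ ≤ B T * (b - a) := by
      intro c hc
      have := intervalIntegral.norm_integral_le_of_norm_le_const (a := a) (b := b) (C := B T)
        (f := fun x : ℝ => g (x + c * I)) (by
          intro x hx
          rw [uIoc_of_le hab] at hx
          have := hbd (x + c * I) (by simpa using hx.1.le) (by simpa using hx.2)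
            (by simpa [hc] using hT)
          simpa [hc] using this)
      rwa [abs_of_nonneg (by linarith)] at this
    have e1 := e (-T) (by rw [abs_neg, abs_of_nonneg (by linarith)])
    have e2 := e T (by rw [abs_of_nonneg (by linarith)])
    push_cast at e1
    set X1 := ∫ x : ℝ in a..b, g (x + -T * I)
    set X2 := ∫ x : ℝ in a..b, g (x + T * I)
    set Y1 := ∫ t in (-T)..T, g (b + t * I)
    set Y2 := ∫ t in (-T)..T, g (a + t * I)
    have H' : X1 - X2 + I * (Y1 - Y2) = 0 := by
      rw [← H]; simp only [X1, X2, Y1, Y2, neg_mul]; ring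
    have : Y1 - Y2 = I * (X1 - X2) := by linear_combination (-I) * H' + (Y1 - Y2) * I_sq
    simp only [id]
    change ‖Y1 - Y2‖ ≤ _
    rw [this, norm_mul, norm_I, one_mul]
    calc _ ≤ ‖X1‖ + ‖X2‖ := norm_sub_le _ _
      _ ≤ _ := by linarith
  have := tendsto_nhds_unique t3 (t2.sub t1)
  exact (sub_eq_zero.mp this.symm).symm

lemma gl_int_sq {c : ℝ} (hc : 0 < c) : Integrable (fun t : ℝ => (c^2 + t^2)⁻¹) ∧
    ∫ t : ℝ, (c^2 + t^2)⁻¹ = Real.pi / c := by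
  have e : (fun t : ℝ => (c^2 + t^2)⁻¹) = fun t => (c^2)⁻¹ * (1 + (c⁻¹ * t)^2)⁻¹ := by
    ext t
    rw [← mul_inv]; congr 1; field_simp
  constructor
  · rw [e]
    exact (integrable_inv_one_add_sq.comp_mul_left' (inv_ne_zero hc.ne')).const_mul _
  · rw [e, integral_const_mul, Measure.integral_comp_mul_left (fun t => (1 + t^2)⁻¹),
      integral_univ_inv_one_add_sq, abs_of_pos (by positivity)]
    simp; field_simp

lemma gl_poisson_bdd {U : ℂ → ℂ} {h σ c M : ℝ} (hσ : h < σ) (hc : 0 < c)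
    (hU : DifferentiableOn ℂ U {s | h < s.re}) (hM : ∀ s : ℂ, h < s.re → ‖U s‖ ≤ M) :
    Integrable (fun t : ℝ => U (σ + t * I) / ((c^2 + t^2 : ℝ) : ℂ)) ∧
    ∫ t : ℝ, U (σ + t * I) / ((c^2 + t^2 : ℝ) : ℂ) = Real.pi / c * U (σ + c) := by
  have hopen : IsOpen {s : ℂ | h < s.re} := isOpen_lt continuous_const continuous_re
  have hline : ∀ b : ℝ, h < b → Continuous (fun t : ℝ => U (b + t * I)) := by
    intro b hb
    apply hU.continuousOn.comp_continuous (by fun_prop)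
    intro t; simpa using hb
  have hM0 : 0 ≤ M := (norm_nonneg _).trans (hM σ (by simpa using hσ))
  have int0 : ∀ C : ℂ, Integrable (fun t : ℝ => (C * ((c^2 + t^2 : ℝ) : ℂ)⁻¹)) := by
    intro C
    have := ((gl_int_sq hc).1.ofReal (𝕜 := ℂ)).const_mul C
    simpa using this
  have intU : Integrable (fun t : ℝ => U (σ + t * I) / ((c^2 + t^2 : ℝ) : ℂ)) := by
    apply Integrable.mono' ((gl_int_sq hc).1.const_mul M)
    · apply Continuous.aestronglyMeasurable
      apply (hline σ hσ).div (by fun_prop)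
      intro t; norm_cast; positivity
    · refine Eventually.of_forall fun t => ?_
      rw [norm_div, norm_real, Real.norm_of_nonneg (by positivity), div_eq_mul_inv]
      gcongr
      exact hM _ (by simpa using hσ)
  refine ⟨intU, ?_⟩
  set w : ℂ := σ + c with hw
  have hwre : w.re = σ + c := by simp [hw]
  set g : ℂ → ℂ := fun s => dslope U w s / (s - σ + c) with hgdef
  have hds : DifferentiableOn ℂ (dslope U w) {s | h < s.re} := by
    rw [Complex.differentiableOn_dslope]
    · exact hU
    · apply hopen.mem_nhds; simp [hwre]; linarith
  have hgd : DifferentiableOn ℂ g {s | σ ≤ s.re} := by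
    apply DifferentiableOn.div
    · apply hds.mono; intro s hs; simp at hs ⊢; linarith
    · fun_prop
    · intro s hs h0
      simp at hs
      have := congrArg re h0
      simp at this; linarith
  have hgne : ∀ s, s ≠ w → g s = (U s - U w) / ((s - σ) ^ 2 - c ^ 2) := by
    intro s hs
    simp only [hgdef]
    rw [dslope_of_ne _ hs, slope_def_field, div_div]
    congr 1; rw [hw]; ring
  have hnum : ∀ s : ℂ, h < s.re → ‖U s - U w‖ ≤ 2 * M := by
    intro s hs
    refine (norm_sub_le _ _).trans ?_
    have := hM s hs
    have := hM w (by rw [hwre]; linarith)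
    linarith
  have hden : ∀ s : ℂ, σ ≤ s.re → (s.re - σ - c)^2 + s.im^2 ≤ ‖(s - σ)^2 - c^2‖ := by
    intro s hs
    have e : (s - σ)^2 - (c:ℂ)^2 = (s - σ - c) * (s - σ + c) := by ring
    have n1 : ‖s - σ - c‖^2 = (s.re - σ - c)^2 + s.im^2 := by
      rw [← normSq_eq_norm_sq, normSq_apply]; simp; ring
    have n2 : ‖s - σ + c‖^2 = (s.re - σ + c)^2 + s.im^2 := by
      rw [← normSq_eq_norm_sq, normSq_apply]; simp; ring
    rw [e, norm_mul, ← n1, sq]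
    gcongr
    apply le_of_sq_le_sq _ (norm_nonneg _)
    rw [n1, n2]
    nlinarith
  have hgb : ∀ s : ℂ, σ ≤ s.re → s ≠ w → ‖g s‖ ≤ 2 * M / ((s.re - σ - c)^2 + s.im^2) := by
    intro s hs hsw
    rw [hgne s hsw, norm_div]
    have hpos : 0 < (s.re - σ - c)^2 + s.im^2 := by
      by_contra hcon
      have z1 : s.re - σ - c = 0 := by nlinarith [sq_nonneg (s.re - σ - c), sq_nonneg s.im]
      have z2 : s.im = 0 := by nlinarith [sq_nonneg (s.re - σ - c), sq_nonneg s.im]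
      apply hsw; apply Complex.ext
      · rw [hwre]; linarith
      · simp [hw, z2]
    gcongr
    · exact hnum s (by linarith)
    · exact hden s hs
  -- the line σ
  have gline : ∀ t : ℝ, g (σ + t * I) = -(U (σ + t * I) / ((c^2 + t^2 : ℝ) : ℂ)
      - U w * ((c^2 + t^2 : ℝ) : ℂ)⁻¹) := by
    intro t
    rw [hgne]
    · have : (((c^2 + t^2 : ℝ)) : ℂ) ≠ 0 := by norm_cast; positivity
      have e2 : ((σ:ℂ) + t * I - σ)^2 - c^2 = - ((c^2 + t^2 : ℝ) : ℂ) := by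
        push_cast; ring_nf; simp [I_sq]
      rw [e2]; field_simp
    · intro h0
      have := congrArg re h0
      simp [hwre] at this; linarith
  have int1 : Integrable (fun t : ℝ => g (σ + t * I)) := by
    simp_rw [gline]
    exact (intU.sub (int0 _)).neg
  have hcont : ∀ b : ℝ, σ ≤ b → Continuous (fun t : ℝ => g (b + t * I)) := by
    intro b hb
    apply hgd.continuousOn.comp_continuous (by fun_prop)
    intro t; simpa using hb
  have gbl : ∀ d : ℝ, 0 < d → ∀ t : ℝ, ‖g ((σ + c + d : ℝ) + t * I)‖ ≤ 2 * M * (d^2 + t^2)⁻¹ := by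
    intro d hd t
    have := hgb ((σ + c + d : ℝ) + t * I) (by simp; linarith) (by
      intro h0
      have := congrArg re h0
      simp [hwre] at this; linarith)
    refine this.trans (le_of_eq ?_)
    simp [div_eq_mul_inv]
    left; ring_nf
  have int2 : ∀ d : ℝ, 0 < d → Integrable (fun t : ℝ => g ((σ + c + d : ℝ) + t * I)) := by
    intro d hd
    apply Integrable.mono' ((gl_int_sq hd).1.const_mul (2 * M))
    · exact (hcont _ (by linarith)).aestronglyMeasurable
    · exact Eventually.of_forall (gbl d hd)
  have small : ∀ d : ℝ, 0 < d → ‖∫ t : ℝ, g (σ + t * I)‖ ≤ 2 * M * (Real.pi / d) := by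
    intro d hd
    rw [gl_shift (a := σ) (b := σ + c + d) (by linarith) (B := fun t => 2 * M / t ^ 2) _ _ _ int1
      (int2 d hd)]
    · refine (norm_integral_le_integral_norm _).trans ?_
      rw [← (gl_int_sq hd).2, ← integral_const_mul]
      exact integral_mono (int2 d hd).norm ((gl_int_sq hd).1.const_mul _) (gbl d hd)
    · exact Tendsto.div_atTop tendsto_const_nhds (tendsto_pow_atTop (by norm_num))
    · apply hgd.mono; intro s hs; exact hs.1
    · intro s hs _ him
      have hne : s ≠ w := by
        rintro rfl; simp [hw] at him; linarith
      refine (hgb s hs hne).trans ?_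
      have : 0 < |s.im| := by linarith
      rw [sq_abs]
      have : 0 < s.im^2 := by rw [← sq_abs]; positivity
      gcongr
      nlinarith [sq_nonneg (s.re - σ - c)]
  have zero : ∫ t : ℝ, g (σ + t * I) = 0 := by
    rw [← norm_le_zero_iff]
    have : Tendsto (fun d : ℝ => 2 * M * (Real.pi / d)) atTop (𝓝 (2 * M * 0)) :=
      (Tendsto.div_atTop tendsto_const_nhds tendsto_id).const_mul _
    rw [mul_zero] at this
    apply ge_of_tendsto this
    filter_upwards [eventually_gt_atTop 0] with d hd using small d hd
  simp_rw [gline] at zero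
  rw [integral_neg, neg_eq_zero, integral_sub intU (int0 _), sub_eq_zero] at zero
  rw [zero, integral_const_mul]
  have : ∫ t : ℝ, (((c^2 + t^2 : ℝ)) : ℂ)⁻¹ = ((Real.pi / c : ℝ) : ℂ) := by
    rw [← (gl_int_sq hc).2, ← integral_complex_ofReal]; simp
  rw [this]; push_cast; ring

lemma gl_poisson {V : ℂ → ℂ} {h σ c : ℝ} (hσ : h < σ) (hc : 0 < c)
    (hV : DifferentiableOn ℂ V {s | h < s.re}) (hpos : ∀ s : ℂ, h < s.re → 0 < (V s).re) :
    Integrable (fun t : ℝ => (V (σ + t * I)).re * (c^2 + t^2)⁻¹) ∧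
    ∫ t : ℝ, (V (σ + t * I)).re * (c^2 + t^2)⁻¹ ≤ Real.pi / c * (V (σ + c)).re := by
  have hline : Continuous (fun t : ℝ => V (σ + t * I)) := by
    apply hV.continuousOn.comp_continuous (by fun_prop)
    intro t; simpa using hσ
  have hposl : ∀ t : ℝ, 0 < (V (σ + t * I)).re := fun t => hpos _ (by simpa using hσ)
  have hc2 : ∀ t : ℝ, 0 < c^2 + t^2 := fun t => by positivity
  have cont : Continuous (fun t : ℝ => (V (σ + t * I)).re * (c^2 + t^2)⁻¹) :=
    (continuous_re.comp hline).mul ((by fun_prop : Continuous fun t : ℝ => c^2 + t^2).inv₀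
      fun t => (hc2 t).ne')
  have key : ∀ T : ℝ, 0 ≤ T → ∫ t in (-T)..T, (V (σ + t * I)).re * (c^2 + t^2)⁻¹ ≤
      Real.pi / c * (V (σ + c)).re := by
    intro T hT
    -- regularisation
    have hne : ∀ ε : ℝ, 0 < ε → ∀ z : ℂ, 0 < z.re → 1 + ε * z ≠ 0 := by
      intro ε hε z hz h0
      have := congrArg re h0
      simp at this; nlinarith
    have hn1 : ∀ ε : ℝ, 0 < ε → ∀ z : ℂ, 0 < z.re → ε * ‖z‖ ≤ ‖1 + ε * z‖ ∧ 1 ≤ ‖1 + ε * z‖ := by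
      intro ε hε z hz
      constructor
      · apply le_of_sq_le_sq _ (norm_nonneg _)
        rw [mul_pow, ← normSq_eq_norm_sq, ← normSq_eq_norm_sq, normSq_apply, normSq_apply]
        simp; nlinarith [mul_pos hε hz]
      · refine le_trans ?_ (re_le_norm _)
        simp; positivity
    have hre : ∀ ε : ℝ, 0 < ε → ∀ z : ℂ, 0 < z.re → 0 ≤ (z / (1 + ε * z)).re := by
      intro ε hε z hz
      rw [div_re, ← add_div]
      apply div_nonneg _ (normSq_nonneg _)
      simp; nlinarith [mul_pos hε hz, mul_pos hz hz, sq_nonneg z.im]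
    have hlim : ∀ z : ℂ, Tendsto (fun n : ℕ => z / (1 + ((1 / ((n:ℝ) + 1) : ℝ) : ℂ) * z)) atTop (𝓝 z) := by
      intro z
      have h1 : Tendsto (fun n : ℕ => ((1 / ((n:ℝ) + 1) : ℝ) : ℂ)) atTop (𝓝 ((0:ℝ):ℂ)) :=
        (continuous_ofReal.tendsto 0).comp tendsto_one_div_add_atTop_nhds_zero_nat
      have h2 := (tendsto_const_nhds (x := z)).div ((tendsto_const_nhds (x := (1:ℂ))).add
        (h1.mul_const z)) (by simp)
      have h3 : z / (1 + ((0:ℝ):ℂ) * z) = z := by simp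
      rw [h3] at h2
      exact h2
    have hle : ∀ n : ℕ, ∫ t in (-T)..T,
        (V (σ + t * I) / (1 + ((1 / ((n:ℝ) + 1) : ℝ) : ℂ) * V (σ + t * I))).re * (c^2 + t^2)⁻¹ ≤
        Real.pi / c * (V (σ + c) / (1 + ((1 / ((n:ℝ) + 1) : ℝ) : ℂ) * V (σ + c))).re := by
      intro n
      set ε : ℝ := 1 / ((n:ℝ) + 1) with hεd
      have hε : 0 < ε := by positivity
      obtain ⟨i1, i2⟩ := gl_poisson_bdd (U := fun s => V s / (1 + ε * V s)) (M := 1 / ε) hσ hc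
        (by
          apply hV.div
          · exact (hV.const_mul _).const_add _
          · intro s hs; exact hne ε hε _ (hpos s hs))
        (by
          intro s hs
          rw [norm_div, div_le_div_iff₀ (by linarith [(hn1 ε hε _ (hpos s hs)).2]) hε]
          have := (hn1 ε hε _ (hpos s hs)).1
          linarith)
      have i3 : ∫ t : ℝ, (V (σ + t * I) / (1 + (ε : ℂ) * V (σ + t * I))).re * (c^2 + t^2)⁻¹ =
          Real.pi / c * (V (σ + c) / (1 + (ε : ℂ) * V (σ + c))).re := by
        have := congrArg re i2
        rw [← Complex.reCLM_apply, ← ContinuousLinearMap.integral_comp_comm _ i1] at this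
        simp only [Complex.reCLM_apply, div_ofReal_re, div_eq_mul_inv _ (_ + _ : ℝ)] at this
        rw [this]
        have e : (Real.pi : ℂ) / c = ((Real.pi / c : ℝ) : ℂ) := by push_cast; rfl
        rw [e, re_ofReal_mul]
      rw [← i3, intervalIntegral.integral_of_le (by linarith)]
      apply setIntegral_le_integral
      · have := i1.re
        simp only [div_eq_mul_inv _ ((_ + _ : ℝ) : ℂ)] at this
        refine this.congr (Eventually.of_forall fun t => ?_)
        simp only [RCLike.re_eq_complex_re]
        rw [← ofReal_inv, re_mul_ofReal]
      · refine Eventually.of_forall fun t => ?_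
        have := hre ε hε _ (hposl t)
        have := hc2 t
        simp only [Pi.zero_apply]; positivity
    have lim1 : Tendsto (fun n : ℕ => ∫ t in (-T)..T,
        (V (σ + t * I) / (1 + ((1 / ((n:ℝ) + 1) : ℝ) : ℂ) * V (σ + t * I))).re * (c^2 + t^2)⁻¹) atTop
        (𝓝 (∫ t in (-T)..T, (V (σ + t * I)).re * (c^2 + t^2)⁻¹)) := by
      apply intervalIntegral.tendsto_integral_filter_of_dominated_convergence
        (fun t => ‖V (σ + t * I)‖ * (c^2 + t^2)⁻¹)
      · refine Eventually.of_forall fun n => ?_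
        apply Continuous.aestronglyMeasurable
        apply Continuous.mul
        · apply continuous_re.comp
          apply hline.div (continuous_const.add (continuous_const.mul hline))
          intro t; exact hne _ (by positivity) _ (hposl t)
        · exact (by fun_prop : Continuous fun t : ℝ => c^2 + t^2).inv₀ fun t => (hc2 t).ne'
      · refine Eventually.of_forall fun n => Eventually.of_forall fun t _ => ?_
        rw [norm_mul, Real.norm_of_nonneg (inv_nonneg.2 (hc2 t).le)]
        gcongr
        refine (abs_re_le_norm _).trans ?_
        rw [norm_div]
        exact div_le_self (norm_nonneg _) (hn1 _ (by positivity) _ (hposl t)).2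
      · apply Continuous.intervalIntegrable
        exact hline.norm.mul ((by fun_prop : Continuous fun t : ℝ => c^2 + t^2).inv₀
          fun t => (hc2 t).ne')
      · refine Eventually.of_forall fun t _ => ?_
        exact ((continuous_re.tendsto _).comp (hlim _)).mul_const _
    have lim2 := (((continuous_re.tendsto _).comp (hlim (V (σ + c)))).const_mul (Real.pi / c))
    exact le_of_tendsto_of_tendsto' lim1 lim2 hle
  have intg : Integrable (fun t : ℝ => (V (σ + t * I)).re * (c^2 + t^2)⁻¹) := by
    apply integrable_of_intervalIntegral_norm_bounded (l := atTop)
      (Real.pi / c * (V (σ + c)).re) (a := fun T : ℝ => -T) (b := fun T => T)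
    · intro T; exact (cont.integrableOn_Icc).mono_set Ioc_subset_Icc_self
    · exact tendsto_neg_atTop_atBot
    · exact tendsto_id
    · filter_upwards [eventually_ge_atTop 0] with T hT
      refine le_trans (le_of_eq ?_) (key T hT)
      congr 1; ext t
      rw [Real.norm_of_nonneg]
      have := hposl t
      have := hc2 t
      positivity
  refine ⟨intg, ?_⟩
  apply le_of_tendsto (intervalIntegral_tendsto_integral intg tendsto_neg_atTop_atBot tendsto_id)
  filter_upwards [eventually_ge_atTop 0] with T hT using key T hT

lemma gl_schwarz_pick {V : ℂ → ℂ} {h : ℝ}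
    (hV : DifferentiableOn ℂ V {s | h < s.re}) (hpos : ∀ s : ℂ, h < s.re → 0 < (V s).re)
    {s : ℂ} (hs : h < s.re) : ‖deriv V s‖ ≤ 2 * (V s).re / (s.re - h) := by
  have hsub : Metric.ball s (s.re - h) ⊆ {z | h < z.re} := by
    intro z hz
    rw [Metric.mem_ball, dist_eq] at hz
    have := (abs_le.1 (abs_re_le_norm (z - s))).1
    simp at this ⊢; linarith
  set W : ℂ → ℂ := fun z => (V z - V s) / (V z + (starRingEnd ℂ) (V s)) with hW
  have hne : ∀ z, h < z.re → V z + (starRingEnd ℂ) (V s) ≠ 0 := by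
    intro z hz h0
    have := congrArg re h0
    simp at this
    linarith [hpos z hz, hpos s hs]
  have hWd : DifferentiableOn ℂ W {s | h < s.re} :=
    (hV.sub_const _).div (hV.add_const _) hne
  have hWs : W s = 0 := by simp [hW]
  have b := norm_deriv_le_div_of_mapsTo_ball (f := W) (c := s) (R₁ := s.re - h) (R₂ := 1)
    (hWd.mono hsub) (by
      intro z hz
      have hz' := hsub hz
      rw [hWs, mem_closedBall_zero_iff]
      simp only [hW]
      rw [norm_div]
      apply div_le_one_of_le₀ _ (norm_nonneg _)
      apply le_of_sq_le_sq _ (norm_nonneg _)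
      rw [← normSq_eq_norm_sq, ← normSq_eq_norm_sq, normSq_apply, normSq_apply]
      simp
      nlinarith [mul_pos (hpos z hz') (hpos s hs)]) (by linarith)
  have hVat : DifferentiableAt ℂ V s :=
    hV.differentiableAt ((isOpen_lt continuous_const continuous_re).mem_nhds hs)
  have hd : deriv W s = deriv V s / (2 * (V s).re : ℝ) := by
    have h2 : V s + (starRingEnd ℂ) (V s) = (2 * (V s).re : ℝ) := by
      rw [add_conj]
    have := ((hVat.hasDerivAt.sub_const (V s)).div (hVat.hasDerivAt.add_const ((starRingEnd ℂ) (V s)))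
      (hne s hs)).deriv
    have e : W = (fun z => V z - V s) / (fun z => V z + (starRingEnd ℂ) (V s)) := by
      ext z; simp [hW]
    rw [e, this, sub_self, zero_mul, sub_zero, h2]
    have : ((2 * (V s).re : ℝ) : ℂ) ≠ 0 := by
      norm_cast; have := hpos s hs; positivity
    field_simp
  have p2 : 0 < 2 * (V s).re := by have := hpos s hs; positivity
  rw [hd, norm_div, norm_real, Real.norm_of_nonneg p2.le, div_le_div_iff₀ p2 (by linarith)] at b
  rw [le_div_iff₀ (by linarith)]
  linarith

lemma gl_growth {V : ℂ → ℂ} {h : ℝ}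
    (hV : DifferentiableOn ℂ V {s | h < s.re}) (hpos : ∀ s : ℂ, h < s.re → 0 < (V s).re)
    {b δ t u : ℝ} (hδ : 0 < δ) (hu : h + δ ≤ u) (hub : u ≤ b) :
    (V (u + t * I)).re ≤ 2 * (b - h) / δ * (1 + (V (b + t * I)).re) := by
  set v0 := V (b + t * I) with hv0
  set f : ℂ → ℂ := fun z => -(V (z + (b + t * I)) - v0.im * I) with hf
  have hpos0 : 0 < v0.re := hpos _ (by simp; linarith)
  have hR : 0 < b - h := by linarith
  have hin : ∀ z ∈ Metric.ball (0:ℂ) (b - h), h < (z + (b + t * I)).re := by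
    intro z hz
    rw [mem_ball_zero_iff] at hz
    have := (abs_le.1 (abs_re_le_norm z)).1
    simp; linarith
  have hnorm : ‖((u - b : ℝ) : ℂ)‖ = b - u := by
    rw [norm_real, Real.norm_eq_abs, abs_of_nonpos (by linarith)]; ring
  have B := borelCaratheodory (f := f) (M := 1) (R := b - h) (z := ((u - b : ℝ) : ℂ)) one_pos
    (by
      apply DifferentiableOn.neg
      apply DifferentiableOn.sub_const
      apply hV.comp (by fun_prop)
      exact hin)
    (by
      intro z hz
      have := hpos _ (hin z hz)
      simp only [hf]; simp at this ⊢; linarith) hR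
    (by rw [mem_ball_zero_iff, hnorm]; linarith)
  rw [hnorm] at B
  have f0 : ‖f 0‖ = v0.re := by
    have : f 0 = -(v0.re : ℂ) := by
      simp only [hf, zero_add, ← hv0]
      nth_rw 1 [← re_add_im v0]; ring
    rw [this, norm_neg, norm_real, Real.norm_of_nonneg hpos0.le]
  have f1 : (V (u + t * I)).re ≤ ‖f ((u - b : ℝ) : ℂ)‖ := by
    simp only [hf]
    rw [norm_neg]
    refine le_trans (le_of_eq ?_) (re_le_norm _)
    have : ((u - b : ℝ) : ℂ) + (b + t * I) = u + t * I := by push_cast; ring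
    rw [this]; simp
  refine f1.trans (B.trans ?_)
  rw [f0]
  have hd : δ ≤ b - h - (b - u) := by linarith
  calc _ ≤ 2 * (b - h) / δ + v0.re * (2 * (b - h)) / δ := by
        gcongr <;> linarith
    _ = _ := by ring

lemma gl_log {g : ℂ → ℂ} {h : ℝ} (hg : DifferentiableOn ℂ g {s | h < s.re})
    (h0 : ∀ s : ℂ, h < s.re → g s ≠ 0) :
    ∃ V : ℂ → ℂ, DifferentiableOn ℂ V {s | h < s.re} ∧ (∀ s : ℂ, h < s.re → exp (V s) = g s) := by
  have hopen : IsOpen {s : ℂ | h < s.re} := isOpen_lt continuous_const continuous_re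
  have hconv : Convex ℝ {s : ℂ | h < s.re} := convex_halfSpace_re_gt h
  have hne : ({s : ℂ | h < s.re}).Nonempty := ⟨(h + 1 : ℝ), by simp⟩
  have hsc : IsSimplyConnected {s : ℂ | h < s.re} := by
    have := hconv.contractibleSpace hne
    show SimplyConnectedSpace _
    infer_instance
  obtain ⟨f, hfc, hfe⟩ := Complex.exists_continuousOn_eqOn_exp_comp hsc hopen hg.continuousOn
    (by rintro ⟨s, hs, h1⟩; exact h0 s hs h1)
  refine ⟨f, ?_, fun s hs => hfe hs⟩
  intro z hz
  have hfz : ContinuousAt f z := hfc.continuousAt (hopen.mem_nhds hz)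
  have hgz : DifferentiableAt ℂ g z := hg.differentiableAt (hopen.mem_nhds hz)
  have hds : ContinuousAt (dslope exp (f z)) (f z) :=
    continuousAt_dslope_same.2 Complex.differentiableAt_exp
  have e1 : dslope exp (f z) (f z) ≠ 0 := by
    rw [dslope_same, Complex.deriv_exp]; exact exp_ne_zero _
  have hcomp : Tendsto (fun w => dslope exp (f z) (f w)) (𝓝 z) (𝓝 (dslope exp (f z) (f z))) :=
    hds.tendsto.comp hfz
  apply DifferentiableAt.differentiableWithinAt
  refine (HasDerivAt.differentiableAt (f' := deriv g z / dslope exp (f z) (f z)) ?_)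
  rw [hasDerivAt_iff_tendsto_slope]
  have t1 := (hasDerivAt_iff_tendsto_slope.1 hgz.hasDerivAt).div
    (hcomp.mono_left nhdsWithin_le_nhds) e1
  refine t1.congr' ?_
  have ev1 : ∀ᶠ w in 𝓝[≠] z, dslope exp (f z) (f w) ≠ 0 :=
    (hcomp.mono_left nhdsWithin_le_nhds).eventually_ne e1
  have ev2 : ∀ᶠ w in 𝓝[≠] z, h < w.re := nhdsWithin_le_nhds (hopen.mem_nhds hz)
  filter_upwards [ev1, ev2] with w hw1 hw2
  have k := sub_smul_dslope exp (f z) (f w)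
  have k1 : exp (f w) = g w := hfe hw2
  have k2 : exp (f z) = g z := hfe hz
  rw [k1, k2, smul_eq_mul] at k
  simp only [Pi.div_apply, slope_def_field]
  rw [← k]; field_simp

lemma gl_charsum {p : ℕ} [NeZero p] {χ : DirichletCharacter ℂ p} (hχ : χ ≠ 1) (n : ℕ) :
    ‖∑ k ∈ Finset.range n, χ (k : ZMod p)‖ ≤ p := by
  have full : ∑ k ∈ Finset.range p, χ (k : ZMod p) = 0 := by
    rw [← MulChar.sum_eq_zero_of_ne_one hχ]
    refine Finset.sum_bij (fun k _ => (k : ZMod p)) (by simp) ?_ ?_ (by simp)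
    · intro a ha b hb hab
      rw [ZMod.natCast_eq_natCast_iff'] at hab
      rwa [Nat.mod_eq_of_lt (Finset.mem_range.1 ha), Nat.mod_eq_of_lt (Finset.mem_range.1 hb)] at hab
    · intro b _
      exact ⟨b.val, Finset.mem_range.2 (ZMod.val_lt b), by simp⟩
  induction n using Nat.strong_induction_on with
  | _ n ih =>
    rcases lt_or_ge n p with h | h
    · refine (norm_sum_le _ _).trans ?_
      refine (Finset.sum_le_sum (g := fun _ => (1:ℝ)) fun i _ => χ.norm_le_one _).trans ?_
      simp; exact h.le
    · obtain ⟨m, rfl⟩ := Nat.exists_eq_add_of_le h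
      rw [Finset.sum_range_add, full, zero_add]
      have := ih m (by have := NeZero.pos p; omega)
      simpa using this

lemma gl_charsum' {p : ℕ} [NeZero p] {χ : DirichletCharacter ℂ p} (hχ : χ ≠ 1) (n : ℕ) :
    ‖∑ k ∈ Finset.Icc 1 n, χ (k : ZMod p)‖ ≤ p + 1 := by
  have h1 := gl_charsum hχ (n+1)
  have e : Finset.range (n+1) = insert 0 (Finset.Icc 1 n) := by
    ext k; simp; omega
  rw [e, Finset.sum_insert (by simp)] at h1
  have h2 := norm_sub_le (χ ((0:ℕ) : ZMod p) + ∑ k ∈ Finset.Icc 1 n, χ (k : ZMod p)) (χ ((0:ℕ) : ZMod p))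
  rw [add_sub_cancel_left] at h2
  have := χ.norm_le_one ((0:ℕ) : ZMod p)
  linarith

lemma gl_Lbound {p : ℕ} [NeZero p] {χ : DirichletCharacter ℂ p} (hχ : χ ≠ 1) {s : ℂ} (hs : 0 < s.re) :
    ‖DirichletCharacter.LFunction χ s‖ ≤ ‖s‖ * ((p + 1) / s.re) := by
  set A : ℝ → ℂ := fun t => ∑ k ∈ Finset.Icc 1 ⌊t⌋₊, χ (k : ZMod p) with hA
  have hAb : ∀ t, ‖A t‖ ≤ p + 1 := fun t => gl_charsum' hχ _
  have hA0 : ∀ t, t < 1 → A t = 0 := by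
    intro t ht
    simp [hA, Nat.floor_eq_zero.2 ht]
  have hAm : Measurable A := (measurable_from_nat (f := fun n => ∑ k ∈ Finset.Icc 1 n, χ (k : ZMod p))).comp Nat.measurable_floor
  have hloc : LocallyIntegrable A := (locallyIntegrable_const ((p:ℝ)+1)).mono hAm.aestronglyMeasurable
    (Eventually.of_forall fun t => (hAb t).trans (le_abs_self _))
  have hmd : ∀ z : ℂ, 0 < z.re → DifferentiableAt ℂ (fun z => z * mellin A (-z)) z := by
    intro z hz
    apply differentiableAt_id.mul
    have := mellin_differentiableAt_of_isBigO_rpow (f := A) (a := 0) (b := -z.re-1) (s := -z)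
      (hloc.locallyIntegrableOn _) ?_ (by simp [hz]) ?_ (by simp)
    · exact DifferentiableAt.comp z (g := mellin A) this differentiableAt_id.neg
    · simp only [neg_zero, Real.rpow_zero]
      exact Asymptotics.IsBigO.of_bound (p+1)
        (Eventually.of_forall fun t => by simpa using hAb t)
    · apply Asymptotics.IsBigO.of_norm_eventuallyLE
      have : ∀ᶠ t in 𝓝[>] (0:ℝ), t < 1 := nhdsWithin_le_nhds (eventually_lt_nhds one_pos)
      filter_upwards [this, self_mem_nhdsWithin] with t ht ht0
      rw [hA0 t ht]; simp; exact Real.rpow_nonneg (le_of_lt ht0) _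
  have hmel : ∀ z : ℂ, mellin A (-z) = ∫ t in Ioi (1:ℝ), A t * (t:ℂ) ^ (-(z+1)) := by
    intro z
    rw [mellin, ← integral_indicator measurableSet_Ioi, ← integral_indicator measurableSet_Ioi]
    apply integral_congr_ae
    have : ∀ᵐ t : ℝ, t ≠ 1 := by simp [ae_iff]
    filter_upwards [this] with t ht
    by_cases h1 : 1 < t
    · rw [indicator_of_mem (show t ∈ Ioi (0:ℝ) from by simp; linarith), indicator_of_mem (show t ∈ Ioi (1:ℝ) from h1)]
      rw [smul_eq_mul, mul_comm]; congr 2; ring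
    · have : A t = 0 := hA0 t (lt_of_le_of_ne (not_lt.1 h1) ht)
      simp [indicator, this]
  have heq1 : ∀ z : ℂ, 1 < z.re → DirichletCharacter.LFunction χ z = z * mellin A (-z) := by
    intro z hz
    rw [DirichletCharacter.LFunction_eq_LSeries χ hz, hmel]
    apply LSeries_eq_mul_integral (fun n => χ (n : ZMod p)) (le_refl 0) (by linarith)
      (DirichletCharacter.LSeriesSummable_of_one_lt_re χ hz)
    simp only [Real.rpow_zero]
    exact Asymptotics.IsBigO.of_bound (p+1)
        (Eventually.of_forall fun n => by simpa using gl_charsum' hχ n)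
  have heq : DirichletCharacter.LFunction χ s = s * mellin A (-s) := by
    have hopen : IsOpen {s : ℂ | 0 < s.re} := isOpen_lt continuous_const continuous_re
    have a1 : AnalyticOnNhd ℂ (DirichletCharacter.LFunction χ) {s : ℂ | 0 < s.re} :=
      (DirichletCharacter.differentiable_LFunction hχ).differentiableOn.analyticOnNhd hopen
    have a2 : AnalyticOnNhd ℂ (fun z => z * mellin A (-z)) {s : ℂ | 0 < s.re} :=
      DifferentiableOn.analyticOnNhd (fun z hz => (hmd z hz).differentiableWithinAt) hopen
    refine a1.eqOn_of_preconnected_of_eventuallyEq a2 (convex_halfSpace_re_gt 0).isPreconnected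
      (z₀ := 2) (by simp) ?_ hs
    filter_upwards [(isOpen_lt continuous_const continuous_re).mem_nhds (show (1:ℝ) < (2:ℂ).re by simp)] with z hz
    exact heq1 z hz
  rw [heq, norm_mul, hmel]
  gcongr
  have : ∫ t in Ioi (1:ℝ), ((p:ℝ)+1) * t ^ (-(s.re+1)) = (p+1)/s.re := by
    rw [integral_const_mul, integral_Ioi_rpow_of_lt (by linarith) one_pos]
    simp; field_simp
  rw [← this]
  apply norm_integral_le_of_norm_le
  · apply Integrable.const_mul
    exact integrableOn_Ioi_rpow_of_lt (by linarith) one_pos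
  · filter_upwards [ae_restrict_mem measurableSet_Ioi] with t ht
    rw [norm_mul, norm_cpow_eq_rpow_re_of_pos (lt_trans one_pos ht)]
    simp only [neg_re, add_re, one_re]
    gcongr
    · exact Real.rpow_nonneg (lt_trans one_pos ht).le _
    · exact hAb t

lemma gl_kernel_ineq {σ c t : ℝ} (hc : c^2 ≤ σ * (σ+1)) :
    c^2 + t^2 ≤ ‖(σ + t * I : ℂ) * (σ + t * I + 1)‖ := by
  apply le_of_sq_le_sq _ (norm_nonneg _)
  rw [norm_mul, mul_pow, ← normSq_eq_norm_sq, ← normSq_eq_norm_sq, normSq_apply, normSq_apply]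
  simp
  have : (c^2+t^2)^2 ≤ (σ * (σ+1) + t^2)^2 := by gcongr
  nlinarith [sq_nonneg t]

/-- the Perron weight -/
noncomputable def glk (t : ℝ) : ℂ :=
  indicator (Ioc 0 1) (fun _ => 1 : ℝ → ℂ) t - indicator (Ioc 0 1) (fun t => ↑t ^ (1:ℂ) : ℝ → ℂ) t

lemma glk_eq {t : ℝ} (ht : 0 < t) : glk t = ((max (1 - t) 0 : ℝ) : ℂ) := by
  unfold glk
  by_cases h : t ≤ 1
  · rw [indicator_of_mem (show t ∈ Ioc (0:ℝ) 1 from ⟨ht, h⟩), indicator_of_mem (show t ∈ Ioc (0:ℝ) 1 from ⟨ht, h⟩), max_eq_left (by linarith)]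
    simp
  · rw [indicator_of_notMem (fun h' => h h'.2), indicator_of_notMem (fun h' => h h'.2), max_eq_right (by linarith)]
    simp

lemma glk_mellin {s : ℂ} (hs : 0 < s.re) : HasMellin glk s (1 / (s * (s+1))) := by
  have h1 := hasMellin_one_Ioc hs
  have h2 := hasMellin_cpow_Ioc 1 (s := s) (by simp; linarith)
  have h3 := hasMellin_sub h1.1 h2.1
  refine ⟨h3.1, h3.2.trans ?_⟩
  rw [h1.2, h2.2]
  have : s ≠ 0 := by rintro rfl; simp at hs
  have : s + 1 ≠ 0 := by intro h; have := congrArg re h; simp at this; linarith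
  field_simp
  ring

lemma gl_kernel_cont {σ : ℝ} (hσ : 0 < σ) : Continuous fun t : ℝ => 1 / ((σ + t * I : ℂ) * (σ + t * I + 1)) := by
  apply Continuous.div continuous_const (by fun_prop)
  intro t
  apply mul_ne_zero
  · intro h; have := congrArg re h; simp at this; linarith
  · intro h; have := congrArg re h; simp at this; linarith

lemma gl_kernel_int {σ : ℝ} (hσ : 1/2 < σ) : Integrable fun t : ℝ => 1 / ((σ + t * I : ℂ) * (σ + t * I + 1)) := by
  refine (gl_int_sq (c := 1/2) (by norm_num)).1.mono' (gl_kernel_cont (by linarith)).aestronglyMeasurable ?_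
  refine Eventually.of_forall fun t => ?_
  rw [norm_div, norm_one, one_div]
  apply inv_anti₀ (by positivity)
  exact gl_kernel_ineq (by nlinarith)

lemma glk_inv {u : ℝ} (hu : 0 < u) : glk u = (1 / (2 * Real.pi) : ℝ) • ∫ y : ℝ, (u : ℂ) ^ (-((2:ℝ) + y * I)) *
    (1 / (((2:ℝ) + y * I : ℂ) * ((2:ℝ) + y * I + 1))) := by
  have hm : ∀ y : ℝ, mellin glk ((2:ℝ) + y * I) = 1 / (((2:ℝ) + y * I : ℂ) * ((2:ℝ) + y * I + 1)) :=
    fun y => (glk_mellin (by simp)).2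
  rw [← mellinInv_mellin_eq 2 glk hu (glk_mellin (by simp)).1]
  · unfold mellinInv
    simp only [hm, smul_eq_mul]
  · unfold VerticalIntegrable
    simp only [hm]
    exact gl_kernel_int (by norm_num)
  · have : glk =ᶠ[𝓝 u] fun t => ((max (1 - t) 0 : ℝ) : ℂ) := by
      filter_upwards [eventually_gt_nhds hu] with t ht using glk_eq ht
    refine ContinuousAt.congr ?_ this.symm
    fun_prop

lemma gl_perron {f : ℕ → ℂ} (hf : LSeriesSummable f 2) {x : ℝ} (hx : 0 < x) {N : ℕ} (hN : x ≤ N) (hf0 : f 0 = 0) :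
    ∑ n ∈ Finset.range N, f n * ((max (1 - n / x) 0 : ℝ) : ℂ) = (1 / (2 * Real.pi) : ℝ) •
      ∫ y : ℝ, LSeries f ((2:ℝ) + y * I) * ((x : ℂ) ^ ((2:ℝ) + y * I : ℂ) *
    (1 / (((2:ℝ) + y * I : ℂ) * ((2:ℝ) + y * I + 1)))) := by
  set K : ℝ → ℂ := fun y => (x : ℂ) ^ ((2:ℝ) + y * I : ℂ) *
    (1 / (((2:ℝ) + y * I : ℂ) * ((2:ℝ) + y * I + 1))) with hK
  have hxc : (x:ℂ) ≠ 0 := by exact_mod_cast hx.ne'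
  have hKi : Integrable K := by
    apply (gl_kernel_int (σ := 2) (by norm_num)).bdd_mul (c := x^2)
    · exact (Continuous.const_cpow (by fun_prop) (Or.inl hxc)).aestronglyMeasurable
    · refine Eventually.of_forall fun t => ?_
      rw [norm_cpow_eq_rpow_re_of_pos hx]; simp
  have hterm : ∀ (n : ℕ) (y : ℝ), ‖LSeries.term f ((2:ℝ) + y * I) n‖ = ‖LSeries.term f 2 n‖ := by
    intro n y
    rw [LSeries.norm_term_eq, LSeries.norm_term_eq]; simp
  have hcont : ∀ n, Continuous fun y : ℝ => LSeries.term f ((2:ℝ) + y * I) n := by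
    intro n
    rcases eq_or_ne n 0 with rfl | h
    · simp only [LSeries.term_zero]; exact continuous_const
    · simp only [LSeries.term_of_ne_zero h]
      have hn : (n:ℂ) ≠ 0 := by exact_mod_cast h
      apply Continuous.div continuous_const (Continuous.const_cpow (by fun_prop) (Or.inl hn))
      intro y; simp [cpow_eq_zero_iff, hn]
  have hFi : ∀ n, Integrable fun y : ℝ => LSeries.term f ((2:ℝ) + y * I) n * K y := by
    intro n
    exact hKi.bdd_mul (hcont n).aestronglyMeasurable (Eventually.of_forall fun y => (hterm n y).le)
  have hs := hasSum_integral_of_summable_integral_norm hFi (by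
    simp only [norm_mul, hterm, integral_const_mul]
    exact hf.norm.mul_right _)
  have e1 : ∀ y : ℝ, ∑' n, LSeries.term f ((2:ℝ) + y * I) n * K y = LSeries f ((2:ℝ) + y * I) * K y := by
    intro y; rw [tsum_mul_right]; rfl
  simp only [e1] at hs
  have hs2 := hs.const_smul (1 / (2 * Real.pi) : ℝ)
  have e2 : ∀ n : ℕ, (1 / (2 * Real.pi) : ℝ) • ∫ y : ℝ, LSeries.term f ((2:ℝ) + y * I) n * K y =
      f n * ((max (1 - n / x) 0 : ℝ) : ℂ) := by
    intro n
    rcases eq_or_ne n 0 with rfl | h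
    · simp [hf0]
    · have hn : (0:ℝ) < n := by positivity
      rw [← glk_eq (by positivity), glk_inv (by positivity), mul_smul_comm, ← integral_const_mul]
      congr 2
      ext y
      rw [LSeries.term_of_ne_zero h, hK]
      have : ((n / x : ℝ) : ℂ) ^ (-((2:ℝ) + y * I)) = (x:ℂ) ^ ((2:ℝ) + y * I : ℂ) / (n:ℂ) ^ ((2:ℝ) + y * I : ℂ) := by
        rw [cpow_neg, div_eq_mul_inv, ofReal_mul, mul_cpow_ofReal_nonneg hn.le (by positivity), mul_inv]
        rw [ofReal_inv, inv_cpow, inv_inv, div_eq_mul_inv, mul_comm]; · rfl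
        rw [arg_ofReal_of_nonneg hx.le]; exact Real.pi_pos.ne
      rw [this]
      simp only [div_eq_mul_inv]; ring
  simp only [e2] at hs2
  rw [← hs2.tsum_eq, tsum_eq_sum]
  intro n hn
  have : x ≤ n := hN.trans (by exact_mod_cast not_lt.1 (by simpa using hn))
  have : 1 ≤ n / x := by rwa [le_div_iff₀ hx, one_mul]
  rw [max_eq_right (by linarith)]; simp

lemma gl_LSeries_bound {f : ℕ → ℂ} (hf : ∀ n, ‖f n‖ ≤ 1) {s : ℂ} (hs : 1 < s.re) (hS : LSeriesSummable f s) :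
    ‖LSeries f s‖ ≤ ‖s‖ / (s.re - 1) := by
  have hb : ∀ n : ℕ, ‖∑ k ∈ Finset.Icc 1 n, f k‖ ≤ n := by
    intro n
    refine (norm_sum_le _ _).trans ?_
    refine (Finset.sum_le_sum (g := fun _ => (1:ℝ)) fun i _ => hf _).trans ?_
    simp
  rw [LSeries_eq_mul_integral f (r := 1) zero_le_one hs hS
    (Asymptotics.IsBigO.of_bound 1 (Eventually.of_forall fun n => by simpa using hb n)), norm_mul,
    div_eq_mul_inv]
  gcongr
  have : ∫ t in Ioi (1:ℝ), t ^ (-s.re) = (s.re - 1)⁻¹ := by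
    rw [integral_Ioi_rpow_of_lt (by linarith) one_pos]
    simp
    rw [show -s.re + 1 = -(s.re - 1) by ring, neg_div_neg_eq, one_div]
  rw [← this]
  apply norm_integral_le_of_norm_le
  · exact integrableOn_Ioi_rpow_of_lt (by linarith) one_pos
  · filter_upwards [ae_restrict_mem measurableSet_Ioi] with t ht
    have ht0 : 0 < t := lt_trans one_pos ht
    rw [norm_mul, norm_cpow_eq_rpow_re_of_pos ht0]
    simp only [neg_re, add_re, one_re]
    have h1 := (hb ⌊t⌋₊).trans (Nat.floor_le ht0.le)
    have h2 : t ^ (-s.re) = t * t ^ (-(s.re+1)) := by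
      rw [← Real.rpow_one_add' ht0.le (by linarith)]; congr 1; ring
    rw [h2]
    gcongr

lemma gl_V (hGRH : GRH) {p : ℕ} [NeZero p] {χ : DirichletCharacter ℂ p} (hχ : χ ≠ 1) :
    ∃ V : ℂ → ℂ, DifferentiableOn ℂ V {s | 1/2 < s.re} ∧ (∀ s : ℂ, 1/2 < s.re → 0 < (V s).re) ∧
    (∀ s : ℂ, 1/2 < s.re → DirichletCharacter.LFunction χ s ≠ 0) ∧
    (∀ s : ℂ, 1/2 < s.re → deriv V s = 1/s -
      deriv (DirichletCharacter.LFunction χ) s / DirichletCharacter.LFunction χ s) ∧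
    (∀ s : ℂ, 1 < s.re → (V s).re ≤ Real.log (2 * (p+1) * ‖s‖ * (‖s‖ / (s.re - 1)))) := by
  have hp : (0:ℝ) ≤ p := by positivity
  have hL : ∀ s : ℂ, 1/2 < s.re → DirichletCharacter.LFunction χ s ≠ 0 := by
    intro s hs h0
    rcases lt_or_ge s.re 1 with h | h
    · have := hGRH p inferInstance χ s h0 (by linarith) h
      linarith
    · exact DirichletCharacter.LFunction_ne_zero_of_one_le_re χ (Or.inl hχ) h h0
  have hLd := DirichletCharacter.differentiable_LFunction hχ
  have hs0 : ∀ s : ℂ, 1/2 < s.re → s ≠ 0 := by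
    rintro s hs rfl; simp at hs; linarith
  have hpc : (2 * ((p:ℂ)+1)) ≠ 0 := by
    have : (2 * ((p:ℂ)+1)) = ((2 * (p + 1) : ℕ) : ℂ) := by push_cast; rfl
    rw [this]; exact Nat.cast_ne_zero.2 (by omega)
  have hpn : ‖(2 * ((p:ℂ)+1))‖ = 2 * (p+1) := by
    have : (2 * ((p:ℂ)+1)) = ((2 * (p + 1) : ℕ) : ℂ) := by push_cast; rfl
    rw [this, Complex.norm_natCast]; push_cast; rfl
  have hd : ∀ s : ℂ, 1/2 < s.re → HasDerivAt (fun s => 2 * ((p:ℂ)+1) * s / DirichletCharacter.LFunction χ s)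
      ((2 * ((p:ℂ)+1) * DirichletCharacter.LFunction χ s - 2 * ((p:ℂ)+1) * s *
        deriv (DirichletCharacter.LFunction χ) s) / DirichletCharacter.LFunction χ s ^ 2) s := by
    intro s hs
    have h1 : HasDerivAt (fun s : ℂ => 2 * ((p:ℂ)+1) * s) (2 * ((p:ℂ)+1)) s := by
      simpa using (hasDerivAt_id s).const_mul (2 * ((p:ℂ)+1))
    exact h1.div (hLd s).hasDerivAt (hL s hs)
  obtain ⟨V, hV, hVe⟩ := gl_log (g := fun s => 2 * ((p:ℂ)+1) * s / DirichletCharacter.LFunction χ s) (h := 1/2)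
    (fun s hs => (hd s hs).differentiableAt.differentiableWithinAt)
    (fun s hs => div_ne_zero (mul_ne_zero hpc (hs0 s hs)) (hL s hs))
  have hre : ∀ s : ℂ, 1/2 < s.re → Real.exp (V s).re = 2 * (p+1) * ‖s‖ / ‖DirichletCharacter.LFunction χ s‖ := by
    intro s hs
    rw [← norm_exp, hVe s hs, norm_div, norm_mul, hpn]
  have hopen : IsOpen {s : ℂ | 1/2 < s.re} := isOpen_lt continuous_const continuous_re
  refine ⟨V, hV, ?_, hL, ?_, ?_⟩
  · intro s hs
    rw [← Real.exp_lt_exp, hre s hs, Real.exp_zero, one_lt_div (norm_pos_iff.2 (hL s hs))]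
    refine (gl_Lbound hχ (by linarith)).trans_lt ?_
    have h1 : 0 < ‖s‖ := norm_pos_iff.2 (hs0 s hs)
    have h2 : (p+1)/s.re < 2 * ((p:ℝ)+1) := by
      rw [div_lt_iff₀ (by linarith)]; nlinarith
    nlinarith
  · intro s hs
    have h1 : HasDerivAt V (deriv V s) s := ((hV s hs).differentiableAt (hopen.mem_nhds hs)).hasDerivAt
    have h2 := h1.cexp
    have h3 : (fun z => exp (V z)) =ᶠ[𝓝 s] (fun s => 2 * ((p:ℂ)+1) * s / DirichletCharacter.LFunction χ s) := by
      filter_upwards [hopen.mem_nhds hs] with z hz using hVe z hz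
    have h4 := (h2.congr_of_eventuallyEq h3.symm).unique (hd s hs)
    rw [hVe s hs] at h4
    have := hL s hs
    have := hs0 s hs
    have hpc' : (p:ℂ) + 1 ≠ 0 := right_ne_zero_of_mul hpc
    field_simp at h4 ⊢
    linear_combination h4
  · intro s hs
    have hs' : 1/2 < s.re := by linarith
    rw [Real.le_log_iff_exp_le (by
      have h1 : 0 < ‖s‖ := norm_pos_iff.2 (hs0 s hs')
      have : 0 < s.re - 1 := by linarith
      positivity), hre s hs', div_eq_mul_inv (2 * (p+1) * ‖s‖ : ℝ)]
    gcongr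
    have h1 := DirichletCharacter.LSeries.mul_mu_eq_one χ hs
    rw [← DirichletCharacter.LFunction_eq_LSeries χ hs] at h1
    have h2 := eq_inv_of_mul_eq_one_right h1
    rw [← norm_inv, ← h2]
    apply gl_LSeries_bound _ hs
    · exact DirichletCharacter.LSeriesSummable_mul χ <| ArithmeticFunction.LSeriesSummable_moebius_iff.mpr hs
    · intro n
      simp only [Pi.mul_apply, norm_mul]
      have h1 := χ.norm_le_one (n : ZMod p)
      have h2 : ‖((ArithmeticFunction.moebius n : ℤ) : ℂ)‖ ≤ 1 := by
        rw [norm_intCast]; exact_mod_cast ArithmeticFunction.abs_moebius_le_one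
      exact mul_le_one₀ h1 (norm_nonneg _) h2

lemma gl_bound (hGRH : GRH) {p : ℕ} [NeZero p] {χ : DirichletCharacter ℂ p} (hχ : χ ≠ 1) {x : ℝ} (hx0 : 0 < x)
    (hx : 50 ≤ Real.log x) {N : ℕ} (hN : x ≤ N) :
    ‖∑ n ∈ Finset.range N, χ (n : ZMod p) * ((ArithmeticFunction.vonMangoldt n : ℝ) : ℂ) * ((max (1 - n / x) 0 : ℝ) : ℂ)‖
      ≤ Real.exp 1 * x^(1/2:ℝ) * (5/4 * Real.log x * Real.log (12 * (p+1)) + 5/4) := by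
  obtain ⟨V, hV, hpos, hL, hVd, hVb⟩ := gl_V hGRH hχ
  have hp : (0:ℝ) ≤ p := by positivity
  have hx1 : 1 < x := by
    by_contra h
    have := Real.log_nonpos hx0.le (not_lt.1 h)
    linarith
  have hopen : IsOpen {s : ℂ | 1/2 < s.re} := isOpen_lt continuous_const continuous_re
  have hxc : (x:ℂ) ≠ 0 := by exact_mod_cast hx0.ne'
  set g : ℂ → ℂ := fun s => (deriv V s - 1/s) * ((x:ℂ)^s * (1/(s*(s+1)))) with hg
  have hs0 : ∀ s : ℂ, 1/2 < s.re → s ≠ 0 ∧ s + 1 ≠ 0 := by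
    intro s hs
    constructor
    · rintro rfl; simp at hs; linarith
    · intro h; have := congrArg re h; simp at this; linarith
  have hgd : DifferentiableOn ℂ g {s | 1/2 < s.re} := by
    apply DifferentiableOn.mul
    · apply (hV.deriv hopen).sub
      exact (differentiableOn_const _).div differentiableOn_id fun s hs => (hs0 s hs).1
    · apply DifferentiableOn.mul
      · intro s hs
        exact (DifferentiableAt.const_cpow differentiableAt_id (Or.inl hxc)).differentiableWithinAt
      · apply (differentiableOn_const _).div (by fun_prop)
        intro s hs; exact mul_ne_zero (hs0 s hs).1 (hs0 s hs).2
  -- basic norm bound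
  have hnorm : ∀ u t : ℝ, 1/2 < u → ‖g (u + t * I)‖ ≤
      x^u * ((2/(u-1/2)) * ((V (u + t * I)).re * ((4/5:ℝ)^2+t^2)⁻¹) + 2 * ((4/5:ℝ)^2+t^2)⁻¹) := by
    intro u t hu
    have hu' : 1/2 < (u + t * I : ℂ).re := by simpa using hu
    have h1 : ‖deriv V (u + t * I) - 1/(u + t * I)‖ ≤ 2/(u-1/2) * (V (u + t * I)).re + 2 := by
      refine (norm_sub_le _ _).trans (add_le_add ?_ ?_)
      · refine (gl_schwarz_pick hV hpos hu').trans (le_of_eq ?_)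
        simp; ring
      · rw [norm_div, norm_one, one_div]
        have : (1/2:ℝ) ≤ ‖(u + t * I : ℂ)‖ := hu'.le.trans (re_le_norm _)
        calc _ ≤ (1/2:ℝ)⁻¹ := inv_anti₀ (by norm_num) this
          _ = 2 := by norm_num
    have h2 : ‖(x:ℂ)^(u + t * I : ℂ)‖ = x^u := by
      rw [norm_cpow_eq_rpow_re_of_pos hx0]; simp
    have h3 : ‖1/((u + t * I : ℂ)*(u + t * I +1))‖ ≤ ((4/5:ℝ)^2+t^2)⁻¹ := by
      rw [norm_div, norm_one, one_div]
      exact inv_anti₀ (by positivity) (gl_kernel_ineq (by nlinarith))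
    rw [hg]
    simp only [norm_mul ((deriv V (u + t * I) - 1/(u + t * I))), norm_mul ((x:ℂ)^(u + t * I : ℂ)), h2]
    calc _ ≤ (2/(u-1/2) * (V (u + t * I)).re + 2) * (x^u * ((4/5:ℝ)^2+t^2)⁻¹) := by
          have := hpos _ hu'
          have : 0 < u - 1/2 := by linarith
          gcongr
      _ = _ := by ring
  have hpoi := fun (u : ℝ) (hu : 1/2 < u) => gl_poisson hu (c := 4/5) (by norm_num) hV hpos
  have hsq := gl_int_sq (c := 4/5) (by norm_num)
  have hdomi : ∀ u : ℝ, 1/2 < u → Integrable fun t : ℝ =>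
      x^u * ((2/(u-1/2)) * ((V (u + t * I)).re * ((4/5:ℝ)^2+t^2)⁻¹) + 2 * ((4/5:ℝ)^2+t^2)⁻¹) := by
    intro u hu
    exact (((hpoi u hu).1.const_mul _).add (hsq.1.const_mul _)).const_mul _
  have hgi : ∀ u : ℝ, 1/2 < u → Integrable fun t : ℝ => g (u + t * I) := by
    intro u hu
    refine (hdomi u hu).mono' ?_ (Eventually.of_forall fun t => hnorm u t hu)
    apply Continuous.aestronglyMeasurable
    apply hgd.continuousOn.comp_continuous (by fun_prop)
    intro t; simpa using hu
  set δ : ℝ := 1 / Real.log x with hδ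
  have hδ0 : 0 < δ := by positivity
  have hδ1 : δ ≤ 1/50 := by
    rw [hδ]; exact one_div_le_one_div_of_le (by norm_num) hx
  set σ : ℝ := 1/2 + δ with hσ
  have hσh : 1/2 < σ := by linarith
  -- shift
  have hshift : ∫ t : ℝ, g (σ + t * I) = ∫ t : ℝ, g ((2:ℝ) + t * I) := by
    set A : ℝ := 2 * (p+1) with hA
    have hA1 : 1 ≤ A := by rw [hA]; linarith
    set M : ℝ := x^2 * (2/δ * (2*(2-1/2)/δ*(1 + (Real.log A + 4 + 2))) + 2) with hM
    apply gl_shift (B := fun t => M / t) (by linarith) (tendsto_const_nhds.div_atTop tendsto_id)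
      (hgd.mono fun s hs => lt_of_lt_of_le hσh hs.1) _ (hgi σ hσh) (hgi 2 (by norm_num))
    intro s hs1 hs2 him
    obtain ⟨u, t, rfl⟩ : ∃ u t : ℝ, s = u + t * I := ⟨s.re, s.im, (re_add_im s).symm⟩
    simp at hs1 hs2 him ⊢
    have hu : 1/2 < u := by linarith
    refine (hnorm u t hu).trans ?_
    have g1 := gl_growth hV hpos (b := 2) (t := t) (u := u) hδ0 (by linarith) hs2
    have g2 : (V ((2:ℝ) + t * I)).re ≤ Real.log A + 4 + 2 * |t| := by
      refine (hVb _ (by simp)).trans ?_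
      have e : ((2:ℝ) + t * I : ℂ).re - 1 = 1 := by simp; norm_num
      have n1 : 0 < ‖((2:ℝ) + t * I : ℂ)‖ := lt_of_lt_of_le (by simp) (re_le_norm _)
      rw [e, div_one, Real.log_mul (by positivity) (by positivity), Real.log_mul (by positivity) (by positivity)]
      have n2 : ‖((2:ℝ) + t * I : ℂ)‖ ≤ 2 + |t| := by
        refine (norm_add_le _ _).trans ?_
        simp
      have n3 := Real.log_le_sub_one_of_pos n1
      linarith
    have hlA := Real.log_nonneg hA1
    have hVp := hpos (u + t * I) (by simpa using hu)
    have g3 : (V (u + t * I)).re ≤ 2*(2-1/2)/δ*(1 + (Real.log A + 4 + 2)) * |t| := by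
      refine g1.trans ?_
      rw [mul_assoc]
      apply mul_le_mul_of_nonneg_left _ (by positivity)
      nlinarith
    have x2 : x^u ≤ x^2 := by
      rw [← Real.rpow_two]; exact Real.rpow_le_rpow_of_exponent_le hx1.le hs2
    have k1 : ((4/5:ℝ)^2+t^2)⁻¹ ≤ (|t| * |t|)⁻¹ := by
      apply inv_anti₀ (by positivity)
      rw [abs_mul_abs_self]; nlinarith
    have d1 : 2/(u-1/2) ≤ 2/δ := by
      apply div_le_div_of_nonneg_left (by norm_num) hδ0; linarith
    have ht0 : 0 < |t| := by linarith
    have d0 : 0 < u - 1/2 := by linarith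
    calc _ ≤ x^2 * (2/δ * (2*(2-1/2)/δ*(1 + (Real.log A + 4 + 2)) * |t| * (|t| * |t|)⁻¹) + 2 * |t| * (|t| * |t|)⁻¹) := by
          gcongr
          linarith
      _ = M / |t| := by
          rw [hM]; field_simp
  have hfin : ‖∫ t : ℝ, g (σ + t * I)‖ ≤ x^σ * (2/δ * (Real.pi/(4/5) * (V (σ + (4/5:ℝ))).re) + 2 * (Real.pi/(4/5))) := by
    refine (norm_integral_le_of_norm_le (hdomi σ hσh) (Eventually.of_forall fun t => hnorm σ t hσh)).trans ?_
    rw [integral_const_mul, integral_add ((hpoi σ hσh).1.const_mul _) (hsq.1.const_mul _), integral_const_mul, integral_const_mul, hsq.2]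
    have := (hpoi σ hσh).2
    have e : σ - 1/2 = δ := by rw [hσ]; ring
    rw [e]
    gcongr
  have hVs : (V (σ + (4/5:ℝ))).re ≤ Real.log (12 * (p+1)) := by
    have e : (σ + (4/5:ℝ) : ℂ) = ((σ + 4/5 : ℝ) : ℂ) := by push_cast; ring
    rw [e]
    refine (hVb _ (by simp; linarith)).trans ?_
    rw [ofReal_re, norm_real, Real.norm_of_nonneg (by linarith)]
    apply Real.log_le_log
    · have : 0 < σ + 4/5 - 1 := by linarith
      have : 0 < σ + 4/5 := by linarith
      positivity
    · have h1 : (σ + 4/5)*((σ + 4/5)/(σ+4/5-1)) ≤ 6 := by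
        rw [← mul_div_assoc, div_le_iff₀ (by linarith)]
        nlinarith
      nlinarith
  have hxσ : x^σ = Real.exp 1 * x^(1/2:ℝ) := by
    rw [hσ, Real.rpow_add hx0, mul_comm]
    congr 1
    rw [Real.rpow_def_of_pos hx0, hδ]; congr 1; field_simp
  have hper := gl_perron (f := fun n => χ (n : ZMod p) * ((ArithmeticFunction.vonMangoldt n : ℝ) : ℂ))
    (DirichletCharacter.LSeriesSummable_twist_vonMangoldt χ (by simp)) hx0 hN (by simp)
  rw [hper]
  have hgg : ∀ y : ℝ, LSeries (fun n => χ (n : ZMod p) * ((ArithmeticFunction.vonMangoldt n : ℝ) : ℂ)) ((2:ℝ) + y * I) * ((x : ℂ) ^ ((2:ℝ) + y * I : ℂ) *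
    (1 / (((2:ℝ) + y * I : ℂ) * ((2:ℝ) + y * I + 1)))) = g ((2:ℝ) + y * I) := by
    intro y
    rw [hg]
    simp only
    congr 1
    have h2 : 1 < ((2:ℝ) + y * I : ℂ).re := by simp
    refine (DirichletCharacter.LSeries_twist_vonMangoldt_eq χ h2).trans ?_
    rw [hVd _ (by linarith), ← DirichletCharacter.deriv_LFunction_eq_deriv_LSeries χ h2, ← DirichletCharacter.LFunction_eq_LSeries χ h2]
    ring
  simp only [hgg]
  rw [← hshift, norm_smul, Real.norm_of_nonneg (by positivity)]
  have hlp : 0 ≤ (V (σ + (4/5:ℝ))).re := (hpos _ (by simp; linarith)).le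
  calc _ ≤ 1/(2*Real.pi) * (x^σ * (2/δ * (Real.pi/(4/5) * (V (σ + (4/5:ℝ))).re) + 2 * (Real.pi/(4/5)))) := by gcongr
    _ = x^σ * (5/4 * Real.log x * (V (σ + (4/5:ℝ))).re + 5/4) := by
      rw [hδ]; field_simp
    _ ≤ _ := by
      rw [hxσ]
      have : 0 ≤ Real.log x := by linarith
      gcongr

end GLAnalytic

lemma gl_char_iff {p : ℕ} [Fact p.Prime] {d : ℕ} (hd : d ∣ p - 1) {χ : MulChar (ZMod p) ℂ} (hχ : orderOf χ = d)
    {a : ZMod p} (ha : a ≠ 0) : χ a = 1 ↔ a ^ ((p-1)/d) = 1 := by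
  have hp1 : 0 < p - 1 := by have := (Fact.out : p.Prime).two_le; omega
  have hd0 : 0 < d := Nat.pos_of_dvd_of_pos hd hp1
  obtain ⟨g, hg⟩ := IsCyclic.exists_generator (α := (ZMod p)ˣ)
  have hog : orderOf g = p - 1 := by
    rw [orderOf_eq_card_of_forall_mem_zpowers hg, Nat.card_eq_fintype_card, ZMod.card_units p]
  obtain ⟨k, hk⟩ := (mem_powers_iff_mem_zpowers).2 (hg (Units.mk0 a ha))
  have hak : a = ((g ^ k : (ZMod p)ˣ) : ZMod p) := by
    simp only at hk; rw [hk]; rfl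
  have hord : ∀ m : ℕ, χ (g : ZMod p) ^ m = 1 ↔ d ∣ m := by
    intro m
    rw [← hχ, orderOf_dvd_iff_pow_eq_one]
    constructor
    · intro h
      ext u
      obtain ⟨j, hj⟩ := (mem_powers_iff_mem_zpowers).2 (hg u)
      simp only at hj
      rw [← hj, Units.val_pow_eq_pow_val, map_pow, MulChar.pow_apply_coe, h, one_pow, ← Units.val_pow_eq_pow_val, MulChar.one_apply_coe]
    · intro h
      rw [← MulChar.pow_apply_coe, h, MulChar.one_apply_coe]
  have e1 : χ a = 1 ↔ d ∣ k := by
    rw [hak, Units.val_pow_eq_pow_val, map_pow, hord]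
  have e2 : a ^ ((p-1)/d) = 1 ↔ d ∣ k := by
    rw [hak, ← Units.val_pow_eq_pow_val, ← pow_mul, Units.val_eq_one, ← orderOf_dvd_iff_pow_eq_one, hog]
    obtain ⟨e, he⟩ := hd
    have he0 : 0 < e := by rcases Nat.eq_zero_or_pos e with h | h; · simp [h] at he; omega
                           · exact h
    rw [he, Nat.mul_div_cancel_left _ hd0]
    exact Nat.mul_dvd_mul_iff_right he0
  rw [e1, e2]

open Classical in
lemma gl_char {p : ℕ} [Fact p.Prime] {d : ℕ} (hd : d ∣ p - 1) {w : ℕ → ℝ} (hw0 : w 0 = 0) {N : ℕ} (hN : N ≤ p) {B : ℝ}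
    (hB0 : 0 ≤ B)
    (hB : ∀ χ : DirichletCharacter ℂ p, χ ≠ 1 → ‖∑ n ∈ Finset.range N, χ (n : ZMod p) * (w n : ℂ)‖ ≤ B) :
    |∑ n ∈ Finset.range N, w n * (if (n : ZMod p) ^ ((p-1)/d) = 1 then 1 else 0) -
      (∑ n ∈ Finset.range N, w n) / d| ≤ B := by
  have hp1 : 0 < p - 1 := by have := (Fact.out : p.Prime).two_le; omega
  have hd0 : 0 < d := Nat.pos_of_dvd_of_pos hd hp1
  have hdr : (0:ℝ) < d := by exact_mod_cast hd0
  obtain ⟨χ, hχ⟩ := MulChar.exists_mulChar_orderOf (ZMod p) (n := d) (by rwa [ZMod.card])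
    (Complex.isPrimitiveRoot_exp d hd0.ne')
  have hsum : ∀ n ∈ Finset.range N, (d:ℂ) * ((w n * (if (n : ZMod p) ^ ((p-1)/d) = 1 then 1 else 0) : ℝ) : ℂ) =
      ∑ j ∈ Finset.range d, (χ^j) (n : ZMod p) * (w n : ℂ) := by
    intro n hn
    rcases Nat.eq_zero_or_pos n with rfl | hn0
    · simp [hw0]
    · have hnp : n < p := lt_of_lt_of_le (Finset.mem_range.1 hn) hN
      have hne : (n : ZMod p) ≠ 0 := by
        rw [Ne, ZMod.natCast_eq_zero_iff]
        exact Nat.not_dvd_of_pos_of_lt hn0 hnp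
      obtain ⟨u, hu⟩ : ∃ u : (ZMod p)ˣ, (u : ZMod p) = n := ⟨Units.mk0 _ hne, rfl⟩
      have hiff := gl_char_iff hd hχ hne
      rw [← Finset.sum_mul]
      have hpow : ∀ j, (χ^j) (n : ZMod p) = (χ n)^j := by
        intro j; rw [← hu, MulChar.pow_apply_coe]
      simp only [hpow]
      by_cases h : χ (n : ZMod p) = 1
      · rw [if_pos (hiff.1 h), h]; simp
      · rw [if_neg (fun h' => h (hiff.2 h'))]
        have h1 : χ (n : ZMod p) ^ d = 1 := by
          rw [← hpow, ← hχ, pow_orderOf_eq_one, ← hu, MulChar.one_apply_coe]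
        rw [geom_sum_eq h, h1]; simp
  have h1 : (d:ℂ) * ((∑ n ∈ Finset.range N, w n * (if (n : ZMod p) ^ ((p-1)/d) = 1 then 1 else 0) : ℝ) : ℂ) =
      ∑ j ∈ Finset.range d, ∑ n ∈ Finset.range N, (χ^j) (n : ZMod p) * (w n : ℂ) := by
    rw [Finset.sum_comm, Complex.ofReal_sum, Finset.mul_sum]
    exact Finset.sum_congr rfl hsum
  obtain ⟨e, rfl⟩ : ∃ e, d = e + 1 := ⟨d - 1, by omega⟩
  rw [Finset.sum_range_succ'] at h1
  have h0 : ∑ n ∈ Finset.range N, (χ^0) (n : ZMod p) * (w n : ℂ) = ((∑ n ∈ Finset.range N, w n : ℝ) : ℂ) := by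
    rw [Complex.ofReal_sum]
    apply Finset.sum_congr rfl
    intro n hn
    rcases Nat.eq_zero_or_pos n with rfl | hn0
    · simp [hw0]
    · have hnp : n < p := lt_of_lt_of_le (Finset.mem_range.1 hn) hN
      have hne : (n : ZMod p) ≠ 0 := by
        rw [Ne, ZMod.natCast_eq_zero_iff]
        exact Nat.not_dvd_of_pos_of_lt hn0 hnp
      rw [pow_zero, MulChar.one_apply (isUnit_iff_ne_zero.2 hne), one_mul]
  rw [h0] at h1
  have h2 : ‖∑ j ∈ Finset.range e, ∑ n ∈ Finset.range N, (χ^(j+1)) (n : ZMod p) * (w n : ℂ)‖ ≤ e * B := by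
    refine (norm_sum_le _ _).trans ?_
    refine (Finset.sum_le_sum (g := fun _ => B) fun j hj => hB _ ?_).trans (by simp)
    intro h
    have := orderOf_dvd_of_pow_eq_one h
    rw [hχ] at this
    have := Nat.le_of_dvd (by omega) this
    have := Finset.mem_range.1 hj
    omega
  rw [← sub_eq_iff_eq_add] at h1
  rw [← h1] at h2
  rw [← Complex.ofReal_natCast, ← Complex.ofReal_mul, ← Complex.ofReal_sub, Complex.norm_real, Real.norm_eq_abs] at h2
  have h3 : ∀ S W : ℝ, S - W / ((e+1 : ℕ):ℝ) = (((e+1:ℕ):ℝ) * S - W) / ((e+1 : ℕ):ℝ) := by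
    intro S W; field_simp
  rw [h3, abs_div, abs_of_pos hdr, div_le_iff₀ hdr]
  refine h2.trans ?_
  push_cast; nlinarith

lemma gl_sieve1 {ι : Type*} (S : Finset ι) (w : ι → ℝ) (e : ℕ → ι → ℝ) (P : Finset ℕ) {W B : ℝ}
    (H : ∀ T ⊆ P, |∑ n ∈ S, w n * ∏ l ∈ T, e l n - W * ∏ l ∈ T, (1/(l:ℝ))| ≤ B) (C : Finset ℕ) :
    ∀ T, C ⊆ P → T ⊆ P → Disjoint T C →
    |∑ n ∈ S, w n * ((∏ l ∈ T, e l n) * ∏ l ∈ C, (1 - e l n)) -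
      W * ((∏ l ∈ T, (1/(l:ℝ))) * ∏ l ∈ C, (1 - 1/(l:ℝ)))| ≤ 2^C.card * B := by
  classical
  induction C using Finset.induction_on with
  | empty => intro T _ hT _; simpa using H T hT
  | insert q C hq ih =>
    intro T hC hT hd
    have hC' : C ⊆ P := fun a ha => hC (Finset.mem_insert_of_mem ha)
    have hqP : q ∈ P := hC (Finset.mem_insert_self _ _)
    rw [Finset.disjoint_insert_right] at hd
    have h1 := ih T hC' hT hd.2
    have h2 := ih (insert q T) hC' (Finset.insert_subset hqP hT) (by
      rw [Finset.disjoint_insert_left]; exact ⟨hq, hd.2⟩)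
    rw [Finset.prod_insert hd.1] at h2
    simp only [Finset.prod_insert hd.1] at h2
    rw [Finset.prod_insert hq, Finset.card_insert_of_notMem hq]
    simp only [Finset.prod_insert hq]
    have e1 : ∑ n ∈ S, w n * ((∏ l ∈ T, e l n) * ((1 - e q n) * ∏ l ∈ C, (1 - e l n))) =
      ∑ n ∈ S, w n * ((∏ l ∈ T, e l n) * ∏ l ∈ C, (1 - e l n)) -
      ∑ n ∈ S, w n * ((e q n * ∏ l ∈ T, e l n) * ∏ l ∈ C, (1 - e l n)) := by
      rw [← Finset.sum_sub_distrib]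
      exact Finset.sum_congr rfl fun n _ => by ring
    rw [e1]
    rw [abs_le] at h1 h2 ⊢
    rw [pow_succ]
    constructor <;> linarith [h1.1, h1.2, h2.1, h2.2]

lemma gl_bernoulli (R : Finset ℕ) (e : ℕ → ℝ) (h0 : ∀ l ∈ R, 0 ≤ e l) (h1 : ∀ l ∈ R, e l ≤ 1) :
    1 - ∑ l ∈ R, e l ≤ ∏ l ∈ R, (1 - e l) ∧ ∏ l ∈ R, (1 - e l) ≤ 1 ∧ 0 ≤ ∏ l ∈ R, (1 - e l) := by
  classical
  induction R using Finset.induction_on with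
  | empty => simp
  | insert q C hq ih =>
    rw [Finset.prod_insert hq, Finset.sum_insert hq]
    obtain ⟨a, b, c⟩ := ih (fun l hl => h0 l (Finset.mem_insert_of_mem hl)) (fun l hl => h1 l (Finset.mem_insert_of_mem hl))
    have := h0 q (Finset.mem_insert_self _ _)
    have := h1 q (Finset.mem_insert_self _ _)
    refine ⟨?_, ?_, ?_⟩ <;> nlinarith

lemma gl_sieve2 {ι : Type*} (S : Finset ι) (w : ι → ℝ) (hw : ∀ n ∈ S, 0 ≤ w n) (e : ℕ → ι → ℝ)
    (he : ∀ l n, 0 ≤ e l n ∧ e l n ≤ 1) (C R : Finset ℕ) (hCR : Disjoint C R) {W B : ℝ}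
    (H : ∀ T ⊆ C ∪ R, |∑ n ∈ S, w n * ∏ l ∈ T, e l n - W * ∏ l ∈ T, (1/(l:ℝ))| ≤ B) :
    W * (∏ l ∈ C, (1 - 1/(l:ℝ))) * (1 - ∑ q ∈ R, 1/(q:ℝ)) - 2^C.card * (1 + R.card) * B ≤
      ∑ n ∈ S, w n * ∏ l ∈ C ∪ R, (1 - e l n) := by
  classical
  have h0 := gl_sieve1 S w e (C ∪ R) H C ∅ Finset.subset_union_left (by simp) (by simp)
  have hq : ∀ q ∈ R, ∑ n ∈ S, w n * (e q n * ∏ l ∈ C, (1 - e l n)) ≤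
      W * (1/(q:ℝ) * ∏ l ∈ C, (1 - 1/(l:ℝ))) + 2^C.card * B := by
    intro q hq
    have := gl_sieve1 S w e (C ∪ R) H C {q} Finset.subset_union_left
      (by simpa using Or.inr hq) (by simpa using Finset.disjoint_right.1 hCR hq)
    simp only [Finset.prod_singleton] at this
    linarith [(abs_le.1 this).2]
  simp only [Finset.prod_empty, one_mul] at h0
  have h0' := (abs_le.1 h0).1
  have hs := Finset.sum_le_sum hq
  calc _ = W * (∏ l ∈ C, (1 - 1/(l:ℝ))) - 2^C.card * B - ∑ q ∈ R, (W * (1/(q:ℝ) * ∏ l ∈ C, (1 - 1/(l:ℝ))) + 2^C.card * B) := by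
        rw [Finset.sum_add_distrib, ← Finset.mul_sum, ← Finset.sum_mul, Finset.sum_const, nsmul_eq_mul]
        ring
    _ ≤ ∑ n ∈ S, w n * ∏ l ∈ C, (1 - e l n) - ∑ q ∈ R, ∑ n ∈ S, w n * (e q n * ∏ l ∈ C, (1 - e l n)) := by linarith
    _ = ∑ n ∈ S, w n * ((∏ l ∈ C, (1 - e l n)) * (1 - ∑ q ∈ R, e q n)) := by
        rw [Finset.sum_comm, ← Finset.sum_sub_distrib]
        refine Finset.sum_congr rfl fun n _ => ?_
        rw [← Finset.mul_sum, ← Finset.sum_mul]; ring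
    _ ≤ _ := by
        refine Finset.sum_le_sum fun n hn => ?_
        rw [Finset.prod_union hCR]
        have := (gl_bernoulli R (fun l => e l n) (fun l _ => (he l n).1) (fun l _ => (he l n).2)).1
        have := (gl_bernoulli C (fun l => e l n) (fun l _ => (he l n).1) (fun l _ => (he l n).2)).2.2
        have := hw n hn
        gcongr

lemma gl_event {p : ℕ} [Fact p.Prime] {T : Finset ℕ} (hT : T ⊆ (p-1).primeFactors) {a : ZMod p} (ha : a ≠ 0) :
    (∏ l ∈ T, l) ∣ p - 1 ∧ (a ^ ((p-1)/∏ l ∈ T, l) = 1 ↔ ∀ l ∈ T, a ^ ((p-1)/l) = 1) := by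
  have hp1 : 0 < p - 1 := by have := (Fact.out : p.Prime).two_le; omega
  have hpr : ∀ l ∈ T, Nat.Prime l := fun l hl => Nat.prime_of_mem_primeFactors (hT hl)
  have hdv : ∀ m, (∏ l ∈ T, l) ∣ m ↔ ∀ l ∈ T, l ∣ m := fun m =>
    ⟨fun h l hl => (Finset.dvd_prod_of_mem _ hl).trans h,
      fun h => Finset.prod_primes_dvd m (fun l hl => (hpr l hl).prime) h⟩
  have hd : (∏ l ∈ T, l) ∣ p - 1 := (hdv _).2 fun l hl => Nat.dvd_of_mem_primeFactors (hT hl)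
  refine ⟨hd, ?_⟩
  have ho : orderOf a ∣ p - 1 := orderOf_dvd_of_pow_eq_one (ZMod.pow_card_sub_one_eq_one ha)
  obtain ⟨m, hm⟩ := ho
  have ho0 : 0 < orderOf a := Nat.pos_of_ne_zero fun h => by simp [h] at hm; omega
  have key : ∀ d, d ∣ p - 1 → (a ^ ((p-1)/d) = 1 ↔ d ∣ m) := by
    intro d hd
    have hd0 : 0 < d := Nat.pos_of_dvd_of_pos hd hp1
    rw [← orderOf_dvd_iff_pow_eq_one, Nat.dvd_div_iff_mul_dvd hd, hm, mul_comm d]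
    exact Nat.mul_dvd_mul_iff_left ho0
  rw [key _ hd, hdv]
  exact forall₂_congr fun l hl => (key l (Nat.dvd_of_mem_primeFactors (hT hl))).symm

open Classical in
lemma gl_exists {p : ℕ} [Fact p.Prime] {w : ℕ → ℝ} (hw : ∀ n, 0 ≤ w n) (hw0 : w 0 = 0) {N : ℕ} (hN : N ≤ p) {B : ℝ}
    (hB0 : 0 ≤ B)
    (hB : ∀ χ : DirichletCharacter ℂ p, χ ≠ 1 → ‖∑ n ∈ Finset.range N, χ (n : ZMod p) * (w n : ℂ)‖ ≤ B)
    {C R : Finset ℕ} (hCR : Disjoint C R) (hU : C ∪ R = (p-1).primeFactors)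
    (hpos : 2^C.card * (1 + R.card) * B < (∑ n ∈ Finset.range N, w n) * (∏ l ∈ C, (1 - 1/(l:ℝ))) * (1 - ∑ q ∈ R, 1/(q:ℝ))) :
    ∃ n, n < N ∧ w n ≠ 0 ∧ orderOf (n : ZMod p) = p - 1 := by
  have hp1 : 0 < p - 1 := by have := (Fact.out : p.Prime).two_le; omega
  set e : ℕ → ℕ → ℝ := fun l n => if (n : ZMod p) ^ ((p-1)/l) = 1 then 1 else 0 with he
  have hne : ∀ n ∈ Finset.range N, w n ≠ 0 → (n : ZMod p) ≠ 0 := by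
    intro n hn hwn
    have hn0 : 0 < n := Nat.pos_of_ne_zero (by rintro rfl; exact hwn hw0)
    have hnp : n < p := lt_of_lt_of_le (Finset.mem_range.1 hn) hN
    rw [Ne, ZMod.natCast_eq_zero_iff]
    exact Nat.not_dvd_of_pos_of_lt hn0 hnp
  have hs := gl_sieve2 (Finset.range N) w (fun n _ => hw n) e (by
    intro l n; simp only [he]; split_ifs <;> simp) C R hCR (W := ∑ n ∈ Finset.range N, w n) (B := B) (by
    intro T hT
    rw [hU] at hT
    have hd : (∏ l ∈ T, l) ∣ p - 1 := (gl_event hT one_ne_zero).1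
    have := gl_char hd hw0 hN hB0 hB
    have e1 : ∑ n ∈ Finset.range N, w n * ∏ l ∈ T, e l n =
      ∑ n ∈ Finset.range N, w n * (if (n : ZMod p) ^ ((p-1)/(∏ l ∈ T, l)) = 1 then 1 else 0) := by
      refine Finset.sum_congr rfl fun n hn => ?_
      by_cases h : w n = 0
      · simp [h]
      · congr 1
        rw [if_congr (gl_event hT (hne n hn h)).2 rfl rfl]
        simp only [he]
        split_ifs with h2
        · exact Finset.prod_eq_one fun l hl => by simp [h2 l hl]
        · push Not at h2
          obtain ⟨l, hl, h3⟩ := h2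
          exact Finset.prod_eq_zero hl (by simp [h3])
    rw [e1]
    convert this using 3
    rw [div_eq_mul_inv]; simp)
  have hlt : 0 < ∑ n ∈ Finset.range N, w n * ∏ l ∈ C ∪ R, (1 - e l n) := by linarith
  obtain ⟨n, hn, hnp⟩ := Finset.exists_lt_of_sum_lt (s := Finset.range N) (f := fun _ => (0:ℝ)) (by simpa using hlt)
  have hwn : w n ≠ 0 := fun h => by simp [h] at hnp
  refine ⟨n, Finset.mem_range.1 hn, hwn, ?_⟩
  apply orderOf_eq_of_pow_and_pow_div_prime hp1 (ZMod.pow_card_sub_one_eq_one (hne n hn hwn))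
  intro q hq hqd h
  have hqm : q ∈ C ∪ R := by rw [hU]; exact Nat.mem_primeFactors.2 ⟨hq, hqd, hp1.ne'⟩
  rw [Finset.prod_eq_zero hqm (by simp [he, h])] at hnp
  simp at hnp

lemma gl_enum (P : Finset ℕ) : ∃ f : ℕ → ℕ, (∀ i < P.card, f i ∈ P) ∧ (∀ i j, i < j → j < P.card → f i < f j) ∧
    P = (Finset.range P.card).image f := by
  classical
  let g := P.orderEmbOfFin rfl
  let f : ℕ → ℕ := fun i => if h : i < P.card then g ⟨i, h⟩ else 0
  have hf : ∀ i (h : i < P.card), f i = g ⟨i, h⟩ := fun i h => dif_pos h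
  have h1 : ∀ i < P.card, f i ∈ P := fun i hi => by
    rw [hf i hi]; exact P.orderEmbOfFin_mem rfl _
  have h2 : ∀ i j, i < j → j < P.card → f i < f j := by
    intro i j hij hj
    rw [hf i (hij.trans hj), hf j hj]
    exact g.strictMono hij
  refine ⟨f, h1, h2, ?_⟩
  symm
  apply Finset.eq_of_subset_of_card_le
  · intro a ha
    obtain ⟨i, hi, rfl⟩ := Finset.mem_image.1 ha
    exact h1 i (Finset.mem_range.1 hi)
  · rw [Finset.card_image_of_injOn, Finset.card_range]
    intro i hi j hj hij
    simp at hi hj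
    rcases lt_trichotomy i j with h | h | h
    · have := h2 i j h hj; omega
    · exact h
    · have := h2 j i h hi; omega

lemma gl_prime_lower {P : Finset ℕ} (hP : ∀ l ∈ P, l.Prime) {f : ℕ → ℕ} (h1 : ∀ i < P.card, f i ∈ P)
    (h2 : ∀ i j, i < j → j < P.card → f i < f j) (i : ℕ) (hi : i < P.card) : 2 ≤ f i ∧ 2 * i + 1 ≤ f i := by
  refine ⟨(hP _ (h1 i hi)).two_le, ?_⟩
  induction i with
  | zero => have := (hP _ (h1 0 hi)).two_le; omega
  | succ i ih =>
    have a := ih (by omega)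
    have b := h2 i (i+1) (by omega) hi
    have c := (hP _ (h1 i (by omega))).two_le
    by_contra hcon
    have d : f (i+1) = 2 * (i+1) := by omega
    have e := hP _ (h1 (i+1) hi)
    rw [d] at e
    have := (Nat.prime_mul_iff.1 e)
    have h4 := e.eq_one_or_self_of_dvd 2 (Dvd.intro _ rfl)
    omega

lemma gl_theta (f : ℕ → ℕ) (n : ℕ) (hf : ∀ i < n, i + 2 ≤ f i) :
    1 / ((n:ℝ) + 1) ≤ ∏ i ∈ Finset.range n, (1 - 1 / (f i : ℝ)) := by
  induction n with
  | zero => simp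
  | succ n ih =>
    rw [Finset.prod_range_succ]
    have h1 := ih fun i hi => hf i (by omega)
    have h2 : (n:ℝ) + 2 ≤ f n := by exact_mod_cast hf n (by omega)
    have h3 : 1 / (f n : ℝ) ≤ 1 / ((n:ℝ) + 2) := one_div_le_one_div_of_le (by positivity) h2
    have h4 : 1 / ((n:ℝ) + 2) ≤ 1 := by rw [div_le_one (by positivity)]; linarith [(Nat.cast_nonneg n : (0:ℝ) ≤ n)]
    calc 1 / (((n+1:ℕ):ℝ) + 1) = 1 / ((n:ℝ) + 1) * (1 - 1 / ((n:ℝ) + 2)) := by push_cast; field_simp; ring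
      _ ≤ _ := by
        apply mul_le_mul h1 (by linarith) (by linarith)
        exact le_trans (by positivity) h1

lemma gl_sum (f : ℕ → ℕ) (n r : ℕ) (hn : 1 ≤ n) (hnr : n ≤ r) (hf : ∀ i < r, 2 * i + 1 ≤ f i) :
    ∑ i ∈ Finset.Ico n r, 1 / (f i : ℝ) ≤ 1/2 * (Real.log r - Real.log n) := by
  induction r, hnr using Nat.le_induction with
  | base => simp
  | succ r hr ih =>
    rw [Finset.sum_Ico_succ_top hr]
    have h1 := ih fun i hi => hf i (by omega)
    have hr0 : (0:ℝ) < r := by exact_mod_cast (by omega : 0 < r)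
    have h2 : 2 * (r:ℝ) + 1 ≤ f r := by exact_mod_cast hf r (by omega)
    have h3 : 1 / (f r : ℝ) ≤ 1 / (2 * (r:ℝ) + 1) := one_div_le_one_div_of_le (by positivity) h2
    have h4 := Real.le_log_one_add_of_nonneg (x := 1/(r:ℝ)) (by positivity)
    have h5 : 2 * (1/(r:ℝ)) / (1/(r:ℝ) + 2) = 2 * (1 / (2 * (r:ℝ) + 1)) := by field_simp; ring
    have h6 : Real.log (1 + 1/(r:ℝ)) = Real.log ((r+1 : ℕ):ℝ) - Real.log r := by
      rw [← Real.log_div (by positivity) hr0.ne']; congr 1; push_cast; field_simp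
    rw [h5, h6] at h4
    linarith

lemma gl_omega_aux (f : ℕ → ℕ) (r : ℕ) (hr : 38 ≤ r) (hf : ∀ i < r, 2 ≤ f i ∧ 2 * i + 1 ≤ f i) :
    Real.exp (3 * r) ≤ ((∏ i ∈ Finset.range r, f i : ℕ) : ℝ) := by
  induction r, hr using Nat.le_induction with
  | base =>
    have h1 : Real.exp (3 * ((38:ℕ):ℝ)) = Real.exp 1 ^ 114 := by rw [← Real.exp_nat_mul]; norm_num
    have h2 : Real.exp 1 ^ 114 ≤ 3 ^ 114 := by gcongr; linarith [Real.exp_one_lt_d9]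
    rw [h1]
    refine h2.trans ?_
    have h3 : ∏ i ∈ Finset.range 38, (2 * i + 1) ≤ ∏ i ∈ Finset.range 38, f i :=
      Finset.prod_le_prod' fun i hi => (hf i (Finset.mem_range.1 hi)).2
    have h4 : 3 ^ 114 ≤ ∏ i ∈ Finset.range 38, (2 * i + 1) := by norm_num [Finset.prod_range_succ]
    exact_mod_cast h4.trans h3
  | succ r hr ih =>
    rw [Finset.prod_range_succ]
    have h1 := ih fun i hi => hf i (by omega)
    have h2 : (27:ℝ) ≤ f r := by exact_mod_cast (by have := (hf r (by omega)).2; omega : 27 ≤ f r)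
    have h3 : Real.exp 3 ≤ 27 := by
      have : Real.exp 3 = Real.exp 1 ^ 3 := by rw [← Real.exp_nat_mul]; norm_num
      rw [this]
      calc Real.exp 1 ^ 3 ≤ 3 ^ 3 := by gcongr; linarith [Real.exp_one_lt_d9]
        _ = 27 := by norm_num
    push_cast at h1 ⊢
    rw [mul_add, Real.exp_add, mul_one]
    exact mul_le_mul h1 (h3.trans h2) (Real.exp_pos _).le (le_trans (Real.exp_pos _).le h1)

lemma gl_split {p : ℕ} (hp : p.Prime) (hp' : 10^49 ≤ p) : ∃ C R : Finset ℕ, Disjoint C R ∧ C ∪ R = (p-1).primeFactors ∧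
    1 / ((C.card:ℝ) + 1) ≤ ∏ l ∈ C, (1 - 1/(l:ℝ)) ∧ ∑ q ∈ R, 1/(q:ℝ) ≤ Real.log 2 ∧
    (C.card : ℝ) ≤ Real.log p / 12 + 3/4 ∧ (R.card : ℝ) ≤ Real.log p / 4 := by
  classical
  set P := (p-1).primeFactors with hPd
  have hP : ∀ l ∈ P, l.Prime := fun l hl => Nat.prime_of_mem_primeFactors hl
  obtain ⟨f, h1, h2, h3⟩ := gl_enum P
  have hlow := gl_prime_lower hP h1 h2
  have hlog : 112 ≤ Real.log p := by
    have : Real.log (2^162) ≤ Real.log p := by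
      apply Real.log_le_log (by positivity)
      exact_mod_cast le_trans (by norm_num) hp'
    rw [Real.log_pow] at this
    have := Real.log_two_gt_d9
    push_cast at *; linarith
  have hp0 : (0:ℝ) < p := by exact_mod_cast hp.pos
  set r := P.card with hr
  have hinj : Set.InjOn f (Finset.range r) := by
    intro i hi j hj hij
    simp at hi hj
    rcases lt_trichotomy i j with h | h | h
    · have := h2 i j h hj; omega
    · exact h
    · have := h2 j i h hi; omega
  have hr3 : (r:ℝ) ≤ Real.log p / 3 := by
    rcases Nat.lt_or_ge r 38 with h | h
    · have : (r:ℝ) ≤ 37 := by exact_mod_cast (by omega : r ≤ 37)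
      linarith
    · have a := gl_omega_aux f r h hlow
      have b : ∏ i ∈ Finset.range r, f i ≤ p := by
        have : ∏ i ∈ Finset.range r, f i = ∏ l ∈ P, l := by
          conv_rhs => rw [h3]
          rw [Finset.prod_image hinj]
        rw [this]
        have : ∏ l ∈ P, l ≤ p - 1 :=
          Nat.le_of_dvd (by have := hp.two_le; omega) (Nat.prod_primeFactors_dvd (p-1))
        omega
      have c : Real.exp (3 * r) ≤ p := a.trans (by exact_mod_cast b)
      have := (Real.le_log_iff_exp_le hp0).2 c
      linarith
  have hr1 : 1 ≤ r := by
    have : P.Nonempty := Nat.nonempty_primeFactors.2 (by omega)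
    exact Finset.card_pos.2 this
  obtain ⟨n, hn⟩ : ∃ n, n = (r+3)/4 := ⟨_, rfl⟩
  have hnr : n ≤ r := by omega
  have hinjC : Set.InjOn f (Finset.range n) := hinj.mono (by
    intro i hi; simp at hi ⊢; omega)
  have hinjR : Set.InjOn f (Finset.Ico n r) := hinj.mono (by
    intro i hi; simp at hi ⊢; omega)
  refine ⟨(Finset.range n).image f, (Finset.Ico n r).image f, ?_, ?_, ?_, ?_, ?_, ?_⟩
  · rw [Finset.disjoint_left]
    intro a ha hb
    obtain ⟨i, hi, rfl⟩ := Finset.mem_image.1 ha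
    obtain ⟨j, hj, hij⟩ := Finset.mem_image.1 hb
    simp at hi hj
    have := h2 i j (by omega) hj.2
    omega
  · rw [← Finset.image_union, h3, Finset.range_eq_Ico, Finset.range_eq_Ico, Finset.Ico_union_Ico_eq_Ico (by omega) hnr]
  · rw [Finset.prod_image hinjC, Finset.card_image_of_injOn hinjC, Finset.card_range]
    apply gl_theta
    intro i hi
    have := hlow i (by omega)
    omega
  · rw [Finset.sum_image hinjR]
    refine (gl_sum f n r (by omega) hnr fun i hi => (hlow i hi).2).trans ?_
    have hn0 : (0:ℝ) < n := by exact_mod_cast (by omega : 0 < n)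
    have : Real.log r ≤ Real.log (2 * 2 * n) := by
      apply Real.log_le_log (by exact_mod_cast hr1)
      exact_mod_cast (by omega : r ≤ 2 * 2 * n)
    rw [Real.log_mul (by norm_num) hn0.ne', Real.log_mul (by norm_num) (by norm_num)] at this
    linarith
  · rw [Finset.card_image_of_injOn hinjC, Finset.card_range]
    have : 4 * (n:ℝ) ≤ r + 3 := by exact_mod_cast (by omega : 4 * n ≤ r + 3)
    linarith
  · rw [Finset.card_image_of_injOn hinjR, Nat.card_Ico, Nat.cast_sub hnr]
    have : (r:ℝ) ≤ 4 * n := by exact_mod_cast (by omega : r ≤ 4 * n)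
    linarith

lemma gl_num {L y x n s B W X : ℝ} (hL : 112 ≤ L) (hy : 0.99 * Real.exp (L/4) ≤ y) (hxy : x = y^2)
    (hn : n ≤ L/12 + 3/4) (hs0 : 0 ≤ s) (hn0 : 0 ≤ n) (hs : s ≤ L/4) (hB0 : 0 ≤ B) (hB : B ≤ 2.7183 * y * (5/8 * L * (L + 5/2) + 5/4))
    (hW : 0.17 * x ≤ W) (hX0 : 0 ≤ X) (hX : X ≤ Real.exp (0.058 * L + 0.52)) :
    X * (1 + s) * B < W * (1/(n+1)) * (1 - Real.log 2) := by
  have hE := Real.exp_pos (L/4)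
  have hy0 : 0 < y := by linarith
  have hl2 := Real.log_two_lt_d9
  have h52 : Real.exp 0.52 ≤ 2.09 := by
    have := Real.add_one_le_exp (-0.52)
    rw [Real.exp_neg] at this
    have h0 := Real.exp_pos 0.52
    have h2 : 0.48 ≤ (Real.exp 0.52)⁻¹ := by linarith
    have h3 := inv_anti₀ (by norm_num) h2
    rw [inv_inv] at h3
    refine h3.trans (by norm_num)
  have h48 : 1.5 * L ≤ Real.exp (0.048 * L) := by
    have e5 : 148 ≤ Real.exp 5 := by
      have : Real.exp 5 = Real.exp 1 ^ 5 := by rw [← Real.exp_nat_mul]; norm_num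
      rw [this]
      calc (148:ℝ) ≤ 2.718^5 := by norm_num
        _ ≤ _ := by gcongr; linarith [Real.exp_one_gt_d9]
    have : Real.exp (0.048 * L) = Real.exp 5 * Real.exp (0.048 * L - 5) := by rw [← Real.exp_add]; congr 1; ring
    rw [this]
    have h1 := Real.add_one_le_exp (0.048 * L - 5)
    calc 1.5 * L ≤ 148 * (0.048 * L - 5 + 1) := by linarith
      _ ≤ _ := by
        apply mul_le_mul e5 h1 (by linarith) (Real.exp_pos _).le
  have h192 : 5 * L^4 ≤ Real.exp (0.192 * L) := by
    have : Real.exp (0.192 * L) = Real.exp (0.048 * L) ^ 4 := by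
      rw [← Real.exp_nat_mul]; congr 1; push_cast; ring
    rw [this]
    calc 5 * L^4 ≤ (1.5 * L)^4 := by rw [mul_pow]; norm_num; gcongr; norm_num
      _ ≤ _ := by gcongr
  set F := Real.exp (0.058 * L) with hF
  have hF0 : 0 < F := Real.exp_pos _
  have hEF : Real.exp (L/4) = Real.exp (0.192 * L) * F := by
    rw [hF, ← Real.exp_add]; congr 1; ring
  have hX' : X ≤ F * 2.09 := by
    refine hX.trans ?_
    rw [Real.exp_add]; gcongr
  have hB' : B ≤ 2.7183 * y * (0.64 * L^2) := by
    refine hB.trans ?_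
    gcongr
    nlinarith
  have key : X * (1 + s) * B * (n+1) < W * (1 - Real.log 2) := by
    calc X * (1 + s) * B * (n+1) ≤ (F * 2.09) * (0.26 * L) * (2.7183 * y * (0.64 * L^2)) * (0.1 * L) := by
          gcongr
          · linarith
          · linarith
      _ = 0.0945403 * L^4 * (F * y) + (2.09*0.26*2.7183*0.64*0.1 - 0.0945403) * (L^4 * (F*y)) := by ring
      _ ≤ 0.1 * L^4 * (F * y) := by
          have : 0 ≤ L^4 * (F * y) := by positivity
          nlinarith
      _ < 0.17 * 0.3 * y * (0.99 * (5 * L^4 * F)) := by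
          have : 0 < L^4 * (F * y) := by positivity
          nlinarith
      _ ≤ 0.17 * 0.3 * y * y := by
          gcongr
          refine le_trans ?_ hy
          rw [hEF]; gcongr
      _ = 0.17 * x * 0.3 := by rw [hxy]; ring
      _ ≤ _ := by
          gcongr
          · have : 0 ≤ x := by rw [hxy]; positivity
            linarith
          · linarith
  rw [mul_one_div, div_mul_eq_mul_div, lt_div_iff₀ (by linarith)]
  exact key

lemma gl_W {x : ℝ} (hx : 10^20 ≤ x) {N : ℕ} (hN : x ≤ N) :
    0.17 * x ≤ ∑ n ∈ Finset.range N, ArithmeticFunction.vonMangoldt n * max (1 - n / x) 0 := by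
  have hx0 : 0 < x := by linarith
  have h1 := Chebyshev.psi_ge' (x := x/2) (by linarith)
  have h2 : 1/2 * Chebyshev.psi (x/2) ≤ ∑ n ∈ Finset.range N, ArithmeticFunction.vonMangoldt n * max (1 - n / x) 0 := by
    rw [Chebyshev.psi, Finset.mul_sum]
    calc _ ≤ ∑ n ∈ Finset.Ioc 0 ⌊x/2⌋₊, ArithmeticFunction.vonMangoldt n * max (1 - n / x) 0 := by
          apply Finset.sum_le_sum
          intro n hn
          have h3 : (n:ℝ) ≤ x/2 := (Nat.le_floor_iff (by linarith)).1 (Finset.mem_Ioc.1 hn).2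
          have h4 : (n:ℝ)/x ≤ 1/2 := by rw [div_le_iff₀ hx0]; linarith
          rw [mul_comm]
          gcongr
          exact le_trans (by linarith) (le_max_left _ _)
      _ ≤ _ := by
          apply Finset.sum_le_sum_of_subset_of_nonneg
          · intro n hn
            have h3 : (n:ℝ) ≤ x/2 := (Nat.le_floor_iff (by linarith)).1 (Finset.mem_Ioc.1 hn).2
            rw [Finset.mem_range]
            exact_mod_cast (by linarith : (n:ℝ) < N)
          · intro n _ _
            exact mul_nonneg ArithmeticFunction.vonMangoldt_nonneg (le_max_right _ _)
  have h3 : Real.log (x/2+2) ≤ (x/2+2)/500 := by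
    set z := Real.sqrt (x/2+2) with hz
    have hzz : z^2 = x/2+2 := Real.sq_sqrt (by linarith)
    have hz1 : 1000 ≤ z := Real.le_sqrt_of_sq_le (by linarith)
    rw [← hzz, Real.log_pow]
    have := Real.log_le_sub_one_of_pos (by linarith : 0 < z)
    push_cast
    nlinarith
  have h4 := Real.log_two_gt_d9
  have h5 := Real.log_two_lt_d9
  nlinarith

lemma gl_log12 {p : ℝ} (hp : 10 ^ 49 ≤ p) : Real.log (12 * (p + 1)) ≤ Real.log p + 5/2 := by
  have hp0 : 0 < p := by linarith
  have h1 : (12.1 : ℝ) ≤ Real.exp (5/2) := by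
    have h2 : Real.exp (5/2) ^ 2 = Real.exp 1 ^ 5 := by
      rw [← Real.exp_nat_mul, ← Real.exp_nat_mul]; norm_num
    have h3 : (2.718 : ℝ) ^ 5 ≤ Real.exp 1 ^ 5 := by
      gcongr
      linarith [Real.exp_one_gt_d9]
    refine le_of_sq_le_sq ?_ (Real.exp_pos _).le
    rw [h2]
    refine le_trans ?_ h3
    norm_num
  have h4 : 12 * (p + 1) ≤ p * Real.exp (5/2) := by nlinarith
  calc _ ≤ Real.log (p * Real.exp (5/2)) := Real.log_le_log (by linarith) h4
    _ = _ := by rw [Real.log_mul hp0.ne' (Real.exp_pos _).ne', Real.log_exp]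

lemma gl_main (hGRH : GRH) (p : ℕ) (hp : p.Prime) (hp' : 10 ^ 49 ≤ p) :
    ∃ q : ℕ, q.Prime ∧ orderOf (q : ZMod p) = p - 1 ∧ (q : ℝ) < Real.sqrt p - 2 := by
  have : Fact p.Prime := ⟨hp⟩
  have : NeZero p := ⟨hp.ne_zero⟩
  have hpR : (10:ℝ) ^ 49 ≤ p := by exact_mod_cast hp'
  have hp0 : (0:ℝ) < p := by linarith
  obtain ⟨C, R, hCR, hU, hprod, hsum, hC, hR⟩ := gl_split hp hp'
  set r := Real.sqrt p with hr
  have hrr : r ^ 2 = p := Real.sq_sqrt hp0.le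
  have hr1 : (10:ℝ) ^ 24 ≤ r := Real.le_sqrt_of_sq_le (le_trans (by norm_num) hpR)
  have hr0 : 0 < r := by linarith
  set L := Real.log p with hL
  have hLr : Real.log r = L / 2 := by
    rw [hL, ← hrr, Real.log_pow]; push_cast; ring
  have h2d := Real.log_two_gt_d9
  have h2u := Real.log_two_lt_d9
  have hL112 : 112 ≤ L := by
    have h1 : Real.log ((2:ℝ) ^ 162) ≤ L := Real.log_le_log (by norm_num) (le_trans (by norm_num) hpR)
    rw [Real.log_pow] at h1
    push_cast at h1
    linarith
  set x := r - 2 with hx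
  have hx20 : (10:ℝ) ^ 20 ≤ x := by linarith
  have hx0 : 0 < x := by linarith
  have hxL : Real.log x ≤ L / 2 := by
    rw [← hLr]; exact Real.log_le_log hx0 (by linarith)
  have hx50 : 50 ≤ Real.log x := by
    have h1 : Real.log (r / 2) ≤ Real.log x := Real.log_le_log (by linarith) (by linarith)
    rw [Real.log_div hr0.ne' (by norm_num), hLr] at h1
    linarith
  have hN : x ≤ (⌈x⌉₊ : ℕ) := Nat.le_ceil x
  have hNp : ⌈x⌉₊ ≤ p := by
    rw [Nat.ceil_le]
    nlinarith
  set N := ⌈x⌉₊ with hNdef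
  set y := x ^ (1/2 : ℝ) with hy
  have hyy : x = y ^ 2 := by
    rw [hy, ← Real.rpow_natCast, ← Real.rpow_mul hx0.le]; norm_num
  have hy0 : 0 ≤ y := by positivity
  have hyL : 0.99 * Real.exp (L/4) ≤ y := by
    have h1 : Real.exp (L/4) ^ 2 = r := by
      rw [← Real.exp_nat_mul, ← Real.exp_log hr0, hLr]; congr 1; push_cast; ring
    refine le_of_sq_le_sq ?_ hy0
    rw [mul_pow, h1, ← hyy]
    nlinarith
  set B := Real.exp 1 * y * (5/4 * Real.log x * Real.log (12*(p+1)) + 5/4) with hB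
  have hl12 := gl_log12 hpR
  have hl0 : 0 ≤ Real.log (12 * ((p:ℝ)+1)) := Real.log_nonneg (by linarith)
  have hB0 : 0 ≤ B := by positivity
  have hBle : B ≤ 2.7183 * y * (5/8 * L * (L + 5/2) + 5/4) := by
    have h1 : Real.exp 1 ≤ 2.7183 := by linarith [Real.exp_one_lt_d9]
    have h2 : 5/4 * Real.log x ≤ 5/8 * L := by linarith
    rw [hB]
    gcongr
  have hW := gl_W hx20 hN
  have hX : (2:ℝ) ^ C.card ≤ Real.exp (0.058 * L + 0.52) := by
    rw [← Real.exp_log (by positivity : (0:ℝ) < 2 ^ C.card), Real.log_pow]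
    apply Real.exp_le_exp.2
    have : (C.card : ℝ) * Real.log 2 ≤ (L/12 + 3/4) * 0.6931471808 := by gcongr
    linarith
  have hnum := gl_num hL112 hyL hyy hC (Nat.cast_nonneg _) (Nat.cast_nonneg _) hR hB0 hBle hW (by positivity) hX
  obtain ⟨n, hnN, hwn, hord⟩ := gl_exists
    (w := fun n => ArithmeticFunction.vonMangoldt n * max (1 - n / x) 0)
    (fun n => mul_nonneg ArithmeticFunction.vonMangoldt_nonneg (le_max_right _ _)) (by rw [ArithmeticFunction.map_zero, zero_mul]) hNp hB0
    (fun χ hχ => by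
      have h := gl_bound hGRH hχ hx0 hx50 hN
      refine le_trans (le_of_eq ?_) h
      congr 1
      apply Finset.sum_congr rfl
      intro n _
      rw [Complex.ofReal_mul, mul_assoc]) hCR hU (by
      refine lt_of_lt_of_le hnum ?_
      have hW0 : 0 ≤ ∑ n ∈ Finset.range N, ArithmeticFunction.vonMangoldt n * max (1 - n / x) 0 :=
        le_trans (by positivity) hW
      have h1 : 0 ≤ 1 - Real.log 2 := by linarith
      have h2 : 1 - Real.log 2 ≤ 1 - ∑ q ∈ R, 1/(q:ℝ) := by linarith
      have h3 : (0:ℝ) ≤ 1 / ((C.card:ℝ) + 1) := Nat.one_div_pos_of_nat.le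
      exact mul_le_mul (mul_le_mul_of_nonneg_left hprod hW0) h2 h1 (mul_nonneg hW0 (h3.trans hprod)))
  have hΛ : ArithmeticFunction.vonMangoldt n ≠ 0 := left_ne_zero_of_mul hwn
  have hmax : max (1 - (n:ℝ) / x) 0 ≠ 0 := right_ne_zero_of_mul hwn
  have hnx : (n:ℝ) < x := by
    by_contra hc
    push Not at hc
    apply hmax
    apply max_eq_right
    rw [sub_nonpos, le_div_iff₀ hx0]
    linarith
  obtain ⟨q, k, hq, hk, hqk⟩ := (isPrimePow_nat_iff _).1 (ArithmeticFunction.vonMangoldt_ne_zero_iff.1 hΛ)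
  have hqn : q ≤ n := by rw [← hqk]; exact Nat.le_self_pow hk.ne' q
  refine ⟨q, hq, ?_, lt_of_le_of_lt (by exact_mod_cast hqn) hnx⟩
  have hq0 : (q : ZMod p) ≠ 0 := by
    rw [Ne, ZMod.natCast_eq_zero_iff]
    intro hd
    have := Nat.le_of_dvd hq.pos hd
    omega
  apply Nat.dvd_antisymm
  · exact orderOf_dvd_of_pow_eq_one (ZMod.pow_card_sub_one_eq_one hq0)
  · rw [← hord, ← hqk, Nat.cast_pow]
    exact orderOf_pow_dvd k

/-- Assume GRH. Then `ĝ(p) < √p - 2` for all primes `p ≥ 10^49`. -/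
theorem grosswald_large (hGRH : GRH) (p : ℕ) (hp : p.Prime) (hp' : 10 ^ 49 ≤ p) :
    (leastPrimePrimitiveRoot p : ℝ) < Real.sqrt p - 2 := by
  obtain ⟨q, hq, hord, hlt⟩ := gl_main hGRH p hp hp'
  have h : leastPrimePrimitiveRoot p ≤ q := Nat.sInf_le ⟨hq, hord⟩
  exact lt_of_le_of_lt (by exact_mod_cast h) hlt
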